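/- arXiv:1303.0854 — 5 statements merged into one kernel-verified Lean document; each statement's English description precedes it below -/
import Mathlib

section
/- For all ℓ ≥ 2 and all n ≥ 4 + ℓ, the coefficient of x^{n-3-ℓ} in the polynomial Q_{n,132}^{(0,1,ℓ,1)}(x) equals C_{ℓ+1} + 6·C_ℓ + 2·C_ℓ·(n-4-ℓ). -/
open Finset Polynomial

/-- `σ i` matches the quadrant marked mesh pattern `MMP(a,b,c,d)` in `σ`:
there are at least `a` indices `j > i` with `σ j > σ i`, at least `b` indices
`j < i` with `σ j > σ i`, at least `c` indices `j < i` with `σ j < σ i`, and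
at least `d` indices `j > i` with `σ j < σ i`. -/
def MatchesMMP {n : ℕ} (a b c d : ℕ) (σ : Equiv.Perm (Fin n)) (i : Fin n) : Prop :=
  a ≤ (Finset.univ.filter (fun j => i < j ∧ σ i < σ j)).card ∧
  b ≤ (Finset.univ.filter (fun j => j < i ∧ σ i < σ j)).card ∧
  c ≤ (Finset.univ.filter (fun j => j < i ∧ σ j < σ i)).card ∧
  d ≤ (Finset.univ.filter (fun j => i < j ∧ σ j < σ i)).card

instance {n : ℕ} (a b c d : ℕ) (σ : Equiv.Perm (Fin n)) :
    DecidablePred (MatchesMMP a b c d σ) := fun i => by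
  unfold MatchesMMP; infer_instance

/-- `mmp a b c d σ` is the number of indices `i` such that `σ i` matches
`MMP(a,b,c,d)` in `σ`. -/
def mmp {n : ℕ} (a b c d : ℕ) (σ : Equiv.Perm (Fin n)) : ℕ :=
  (Finset.univ.filter (MatchesMMP a b c d σ)).card

/-- `σ` avoids the classical pattern 132. -/
def Avoids132 {n : ℕ} (σ : Equiv.Perm (Fin n)) : Prop :=
  ¬ ∃ i j k : Fin n, i < j ∧ j < k ∧ σ i < σ k ∧ σ k < σ j

instance {n : ℕ} : DecidablePred (Avoids132 (n := n)) := fun σ => by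
  unfold Avoids132; infer_instance

/-- The set `S_n(132)` of 132-avoiding permutations of `{1,…,n}`. -/
def Av132 (n : ℕ) : Finset (Equiv.Perm (Fin n)) :=
  Finset.univ.filter Avoids132

/-- `Q n a b c d = Σ_{σ ∈ S_n(132)} x^{mmp^{(a,b,c,d)}(σ)}`, a polynomial in `ℤ[x]`. -/
noncomputable def Q (n a b c d : ℕ) : Polynomial ℤ :=
  ∑ σ ∈ Av132 n, Polynomial.X ^ (mmp a b c d σ)


abbrev BT := BinaryTree Unit

open BinaryTree in
/-- the statistic on binary trees corresponding to `mmp 0 b c d` -/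
def st : BT → ℕ → ℕ → ℕ → ℕ
  | .nil, _, _, _ => 0
  | .node _ A B, b, c, d =>
      st A b c (d - B.numNodes) + (if b = 0 ∧ c ≤ A.numNodes ∧ d ≤ B.numNodes then 1 else 0)
        + st B (b - (A.numNodes + 1)) c d

namespace TreeCount
open BinaryTree

variable {l : ℕ}

def nd (A B : BT) : BT := .node () A B
def lf : BT := nd .nil .nil

lemma numNodes_nd (A B : BT) : (nd A B).numNodes = A.numNodes + B.numNodes + 1 := rfl
lemma numNodes_lf : lf.numNodes = 1 := rfl
lemma numNodes_nil : (BinaryTree.nil : BT).numNodes = 0 := rfl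

lemma nn_zero {A : BT} (h : A.numNodes = 0) : A = .nil := by
  cases A with
  | nil => rfl
  | node _ a b => simp [numNodes] at h

lemma nn_one {A : BT} (h : A.numNodes = 1) : A = lf := by
  cases A with
  | nil => simp [numNodes] at h
  | node _ a b =>
    simp [numNodes] at h
    rw [nn_zero h.1, nn_zero h.2]; rfl

lemma nn_two {A : BT} (h : A.numNodes = 2) : A = nd lf .nil ∨ A = nd .nil lf := by
  cases A with
  | nil => simp [numNodes] at h
  | node _ a b =>
    have h : a.numNodes + b.numNodes = 1 := by simpa [numNodes] using h
    rcases Nat.eq_zero_or_pos a.numNodes with h0 | h0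
    · right; rw [nn_zero h0, nn_one (A := b) (by omega)]; rfl
    · left; rw [nn_zero (A := b) (by omega), nn_one (A := a) (by omega)]; rfl

def K (l : ℕ) (t : BT) := st t 0 l 0
def H (l : ℕ) (t : BT) := st t 0 l 1
def G (l : ℕ) (t : BT) := st t 1 l 0
def F (l : ℕ) (t : BT) := st t 1 l 1

lemma K_nil : K l .nil = 0 := rfl
lemma H_nil : H l .nil = 0 := rfl
lemma G_nil : G l .nil = 0 := rfl
lemma F_nil : F l .nil = 0 := rfl

lemma K_node (A B : BT) : K l (nd A B) = K l A + (if l ≤ A.numNodes then 1 else 0) + K l B := by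
  simp [K, nd, st]

lemma H_node (A B : BT) : H l (nd A B) =
    if B.numNodes = 0 then H l A else K l A + (if l ≤ A.numNodes then 1 else 0) + H l B := by
  split_ifs with h1 h2
  · rw [nn_zero h1]; simp [H, nd, st, numNodes]
  · have : 1 - B.numNodes = 0 := by omega
    have : 1 ≤ B.numNodes := by omega
    simp [H, K, nd, st, *]
  · have : 1 - B.numNodes = 0 := by omega
    simp [H, K, nd, st, *]

lemma G_node (A B : BT) : G l (nd A B) = G l A + K l B := by
  simp [G, K, nd, st]

lemma F_node (A B : BT) : F l (nd A B) =
    if B.numNodes = 0 then F l A else G l A + H l B := by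
  split_ifs with h1
  · rw [nn_zero h1]; simp [F, nd, st, numNodes]
  · have : 1 - B.numNodes = 0 := by omega
    simp [F, G, H, nd, st, *]

lemma K_le (t : BT) : K l t ≤ t.numNodes - l := by
  induction t with
  | nil => simp [K_nil]
  | node _ A B ihA ihB =>
    change K l (nd A B) ≤ (nd A B).numNodes - l
    rw [K_node, numNodes_nd]; first | (split_ifs <;> omega) | grind

lemma H_le (t : BT) : H l t ≤ t.numNodes - (l + 1) := by
  induction t with
  | nil => simp [H_nil]
  | node _ A B ihA ihB =>
    change H l (nd A B) ≤ (nd A B).numNodes - (l+1)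
    have := K_le (l := l) A
    rw [H_node, numNodes_nd]; first | (split_ifs <;> omega) | grind

lemma G_le (t : BT) : G l t ≤ t.numNodes - (l + 1) := by
  induction t with
  | nil => simp [G_nil]
  | node _ A B ihA ihB =>
    change G l (nd A B) ≤ (nd A B).numNodes - (l+1)
    have := K_le (l := l) B
    rw [G_node, numNodes_nd]; omega

lemma F_le (t : BT) : F l t ≤ t.numNodes - (l + 2) := by
  induction t with
  | nil => simp [F_nil]
  | node _ A B ihA ihB =>
    change F l (nd A B) ≤ (nd A B).numNodes - (l+2)
    have := H_le (l := l) B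
    have := G_le (l := l) A
    rw [F_node, numNodes_nd]; first | (split_ifs <;> omega) | grind

/-- trees with `n` nodes and statistic `v` -/
def S (f : BT → ℕ) (n v : ℕ) : Finset BT := (treesOfNumNodesEq n).filter (fun t => f t = v)

lemma mem_S {f : BT → ℕ} {n v : ℕ} {t : BT} : t ∈ S f n v ↔ t.numNodes = n ∧ f t = v := by
  simp [S]

lemma nd_inj {A B A' B' : BT} : nd A B = nd A' B' ↔ A = A' ∧ B = B' := by
  simp [nd]

def L (X : BT) (s : Finset BT) : Finset BT := s.image (fun A => nd A X)
def R (X : BT) (s : Finset BT) : Finset BT := s.image (fun B => nd X B)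

lemma card_L (X : BT) (s : Finset BT) : #(L X s) = #s :=
  card_image_of_injective _ (fun _ _ h => (nd_inj.1 h).1)
lemma card_R (X : BT) (s : Finset BT) : #(R X s) = #s :=
  card_image_of_injective _ (fun _ _ h => (nd_inj.1 h).2)

lemma mem_L {X : BT} {s : Finset BT} {A B : BT} : nd A B ∈ L X s ↔ A ∈ s ∧ B = X := by
  simp only [L, mem_image, nd_inj]; aesop
lemma mem_R {X : BT} {s : Finset BT} {A B : BT} : nd A B ∈ R X s ↔ B ∈ s ∧ A = X := by
  simp only [R, mem_image, nd_inj]; aesop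
lemma nil_L {X : BT} {s : Finset BT} : .nil ∉ L X s := by simp [L, nd]
lemma nil_R {X : BT} {s : Finset BT} : .nil ∉ R X s := by simp [R, nd]

lemma ext_nd {s t : Finset BT} (h0 : .nil ∉ s) (h1 : .nil ∉ t)
    (h : ∀ A B, nd A B ∈ s ↔ nd A B ∈ t) : s = t := by
  ext x
  cases x with
  | nil => simp [h0, h1]
  | node _ A B => exact h A B

lemma disj_nd {s t : Finset BT} (h0 : .nil ∉ s)
    (h : ∀ A B, nd A B ∈ s → nd A B ∈ t → False) : Disjoint s t := by
  rw [disjoint_left]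
  intro x
  cases x with
  | nil => simp [h0]
  | node _ A B => exact h A B

lemma nil_S {f : BT → ℕ} {n v : ℕ} (h : 0 < n) : .nil ∉ S f n v := by
  simp [mem_S]; omega

lemma Kz (v : ℕ) (h : v = 0) : #(S (K l) l v) = catalan l := by
  rw [← treesOfNumNodesEq_card_eq_catalan]
  congr 1
  ext t
  rw [mem_S, mem_treesOfNumNodesEq]
  have := K_le (l := l) t
  omega

lemma Ktop (hl : 1 ≤ l) (j : ℕ) : #(S (K l) (l + j) j) = catalan l := by
  induction j with
  | zero => exact Kz 0 rfl
  | succ j ih =>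
    rw [← ih, ← card_L .nil (S (K l) (l + j) j)]
    congr 1
    refine ext_nd (nil_S (by omega)) nil_L fun A B => ?_
    rw [mem_L, mem_S, mem_S, K_node, numNodes_nd]
    constructor
    · rintro ⟨h1, h2⟩
      have hA := K_le (l := l) A
      have hB := K_le (l := l) B
      have h0 : B = .nil := by
        apply nn_zero
        split_ifs at h2 <;> omega
      subst h0
      simp only [K_nil, numNodes_nil] at *
      first | (split_ifs at h2 <;> simp <;> omega) | grind
    · rintro ⟨⟨h1, h2⟩, rfl⟩
      simp only [K_nil, numNodes_nil] at *
      first | (split_ifs <;> omega) | grind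

lemma K2 (hl : 2 ≤ l) (j : ℕ) :
    #(S (K l) (l + 1 + j) j) + catalan l = catalan (l + 1) + 2 * catalan l * j := by
  induction j with
  | zero =>
    have := Ktop (l := l) (by omega) 1
    rw [← this, ← treesOfNumNodesEq_card_eq_catalan (l+1), ← card_union_of_disjoint]
    · simp only [mul_zero, add_zero]
      congr 1
      ext t
      simp only [mem_union, mem_S, mem_treesOfNumNodesEq]
      have := K_le (l := l) t
      omega
    · rw [disjoint_left]
      intro t
      simp only [mem_S]
      omega
  | succ j ih =>
    have e : S (K l) (l + 1 + (j+1)) (j+1) =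
        L .nil (S (K l) (l + 1 + j) j) ∪ (L lf (S (K l) (l + j) j) ∪
          R .nil (S (K l) (l + (j + 1)) (j + 1))) := by
      refine ext_nd (nil_S (by omega)) (by simp [nil_L, nil_R]) fun A B => ?_
      simp only [mem_union, mem_L, mem_R, mem_S, K_node, numNodes_nd]
      constructor
      · rintro ⟨h1, h2⟩
        have hA := K_le (l := l) A
        have hB := K_le (l := l) B
        have h0 : B.numNodes = 0 ∨ B.numNodes = 1 ∨ A.numNodes = 0 := by
          split_ifs at h2 <;> omega
        rcases h0 with h0 | h0 | h0
        · obtain rfl := nn_zero h0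
          simp only [K_nil, numNodes_nil] at *
          first | (split_ifs at h2 <;> simp <;> omega) | grind
        · obtain rfl := nn_one h0
          simp only [numNodes_lf] at *
          first | (split_ifs at h2 <;> simp <;> omega) | grind
        · obtain rfl := nn_zero h0
          simp only [K_nil, numNodes_nil] at *
          first | (split_ifs at h2 <;> simp <;> omega) | grind
      · rintro (⟨⟨h1, h2⟩, rfl⟩ | ⟨⟨h1, h2⟩, rfl⟩ | ⟨⟨h1, h2⟩, rfl⟩)
        · simp only [K_nil, numNodes_nil] at *
          first | (split_ifs <;> omega) | grind
        · have hB := K_le (l := l) lf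
          simp only [numNodes_lf] at *
          first | (split_ifs <;> omega) | grind
        · simp only [K_nil, numNodes_nil] at *
          first | (split_ifs <;> omega) | grind
    rw [e, card_union_of_disjoint, card_union_of_disjoint, card_L, card_L, card_R, Ktop (by omega),
      Ktop (by omega)]
    · linarith
    all_goals
      refine disj_nd (by simp [nil_L, nil_R]) fun A B => ?_
      simp only [mem_union, mem_L, mem_R, mem_S]
      grind [numNodes_nil, numNodes_lf]

lemma Htop (hl : 2 ≤ l) (j : ℕ) : #(S (H l) (l + 2 + j) (j + 1)) = catalan l := by
  rw [← Ktop (by omega) j, ← card_L lf (S (K l) (l + j) j)]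
  congr 1
  refine ext_nd (nil_S (by omega)) nil_L fun A B => ?_
  rw [mem_L, mem_S, mem_S, H_node, numNodes_nd]
  have hB := H_le (l := l) B
  constructor
  · rintro ⟨h1, h2⟩
    have hA := K_le (l := l) A
    have hA' := H_le (l := l) A
    have h0 : B = lf := by
      apply nn_one
      split_ifs at h2 <;> omega
    subst h0
    simp only [numNodes_lf] at *
    first | (split_ifs at h2 <;> simp <;> omega) | grind
  · rintro ⟨⟨h1, h2⟩, rfl⟩
    simp only [numNodes_lf] at *
    first | (split_ifs <;> omega) | grind

lemma Gtop (hl : 2 ≤ l) (j : ℕ) : #(S (G l) (l + 2 + j) (j + 1)) = catalan l := by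
  rw [← Ktop (by omega) (j+1), ← card_R .nil (S (K l) (l + (j + 1)) (j + 1))]
  congr 1
  refine ext_nd (nil_S (by omega)) nil_R fun A B => ?_
  rw [mem_R, mem_S, mem_S, G_node, numNodes_nd]
  have hB := K_le (l := l) B
  constructor
  · rintro ⟨h1, h2⟩
    have hA := G_le (l := l) A
    have h0 : A = .nil := by
      apply nn_zero
      omega
    subst h0
    simp only [numNodes_nil, G_nil] at *
    simp; omega
  · rintro ⟨⟨h1, h2⟩, rfl⟩
    simp only [numNodes_nil, G_nil] at *
    omega

lemma Ftop (hl : 2 ≤ l) (j : ℕ) : #(S (F l) (l + 3 + j) (j + 1)) = catalan l := by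
  rw [← Htop (by omega) j, ← card_R .nil (S (H l) (l + 2 + j) (j + 1))]
  congr 1
  refine ext_nd (nil_S (by omega)) nil_R fun A B => ?_
  rw [mem_R, mem_S, mem_S, F_node, numNodes_nd]
  have hB := H_le (l := l) B
  constructor
  · rintro ⟨h1, h2⟩
    have hA := G_le (l := l) A
    have hA' := F_le (l := l) A
    have h0 : A = .nil := by
      apply nn_zero
      split_ifs at h2 <;> omega
    subst h0
    simp only [numNodes_nil, G_nil, F_nil] at *
    first | (split_ifs at h2 <;> simp <;> omega) | grind
  · rintro ⟨⟨h1, h2⟩, rfl⟩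
    simp only [numNodes_nil, G_nil, F_nil] at *
    first | (split_ifs <;> omega) | grind

lemma H2 (hl : 2 ≤ l) (j : ℕ) :
    #(S (H l) (l + 3 + j) (j + 1)) = catalan (l + 1) + 3 * catalan l + 2 * catalan l * j := by
  have e : S (H l) (l + 3 + j) (j+1) =
      L .nil (S (H l) (l + 2 + j) (j + 1)) ∪ (L lf (S (K l) (l + 1 + j) j) ∪
        (L (nd lf .nil) (S (K l) (l + j) j) ∪ (L (nd .nil lf) (S (K l) (l + j) j) ∪
          R .nil (S (H l) (l + 2 + j) (j + 1))))) := by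
    refine ext_nd (nil_S (by omega)) (by simp [nil_L, nil_R]) fun A B => ?_
    simp only [mem_union, mem_L, mem_R, mem_S, H_node, numNodes_nd]
    have hB := H_le (l := l) B
    constructor
    · rintro ⟨h1, h2⟩
      have hA := K_le (l := l) A
      have hA' := H_le (l := l) A
      have h0 : B.numNodes = 0 ∨ B.numNodes = 1 ∨ B.numNodes = 2 ∨
          (B.numNodes ≠ 0 ∧ A.numNodes = 0) := by
        split_ifs at h2 <;> omega
      rcases h0 with h0 | h0 | h0 | ⟨h0', h0⟩
      · obtain rfl := nn_zero h0
        simp only [H_nil, numNodes_nil] at *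
        first | (split_ifs at h2 <;> simp <;> omega) | grind
      · obtain rfl := nn_one h0
        simp only [numNodes_lf] at *
        first | (split_ifs at h2 <;> simp <;> omega) | grind
      · rw [if_neg (by omega)] at h2
        have h3 : A.numNodes = l + j ∧ K l A = j := by
          split_ifs at h2 <;> omega
        rcases nn_two h0 with h | h <;> simp [h, h3]
      · obtain rfl := nn_zero h0
        simp only [K_nil, numNodes_nil] at *
        rw [if_neg h0'] at h2
        first | (split_ifs at h2 <;> simp <;> omega) | grind
    · rintro (⟨⟨h1, h2⟩, rfl⟩ | ⟨⟨h1, h2⟩, rfl⟩ | ⟨⟨h1, h2⟩, rfl⟩ | ⟨⟨h1, h2⟩, rfl⟩ | ⟨⟨h1, h2⟩, rfl⟩)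
      all_goals
        simp only [K_nil, H_nil, numNodes_nil, numNodes_lf, numNodes_nd] at *
        first | (split_ifs <;> omega) | grind
  rw [e, card_union_of_disjoint, card_union_of_disjoint, card_union_of_disjoint,
    card_union_of_disjoint, card_L, card_L, card_L, card_L, card_R, Ktop (by omega), Htop hl]
  · have := K2 hl j
    linarith
  all_goals
    refine disj_nd (by simp [nil_L, nil_R]) fun A B => ?_
    simp only [mem_union, mem_L, mem_R, mem_S]
    have h3 : nd lf .nil ≠ nd .nil lf := by simp [nd, lf]
    grind [numNodes_nil, numNodes_lf, numNodes_nd]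

lemma F2 (hl : 2 ≤ l) (j : ℕ) :
    #(S (F l) (l + 4 + j) (j + 1)) = catalan (l + 1) + 6 * catalan l + 2 * catalan l * j := by
  have e : S (F l) (l + 4 + j) (j+1) =
      L .nil (S (F l) (l + 3 + j) (j + 1)) ∪ (L lf (S (G l) (l + 2 + j) (j + 1)) ∪
        (R lf (S (H l) (l + 2 + j) (j + 1)) ∪
          R .nil (S (H l) (l + 3 + j) (j + 1)))) := by
    refine ext_nd (nil_S (by omega)) (by simp [nil_L, nil_R]) fun A B => ?_
    simp only [mem_union, mem_L, mem_R, mem_S, F_node, numNodes_nd]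
    have hB := H_le (l := l) B
    have hA := G_le (l := l) A
    constructor
    · rintro ⟨h1, h2⟩
      have hA' := F_le (l := l) A
      have h0 : B.numNodes = 0 ∨ B.numNodes = 1 ∨ (B.numNodes ≠ 0 ∧ A.numNodes = 1) ∨
          (B.numNodes ≠ 0 ∧ A.numNodes = 0) := by
        split_ifs at h2 <;> omega
      rcases h0 with h0 | h0 | ⟨h0', h0⟩ | ⟨h0', h0⟩
      · obtain rfl := nn_zero h0
        simp only [H_nil, numNodes_nil] at *
        first | (split_ifs at h2 <;> simp <;> omega) | grind
      · obtain rfl := nn_one h0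
        simp only [numNodes_lf] at *
        first | (split_ifs at h2 <;> simp <;> omega) | grind
      · obtain rfl := nn_one h0
        simp only [numNodes_lf] at *
        rw [if_neg h0'] at h2
        simp; omega
      · obtain rfl := nn_zero h0
        simp only [G_nil, numNodes_nil] at *
        rw [if_neg h0'] at h2
        simp; omega
    · rintro (⟨⟨h1, h2⟩, rfl⟩ | ⟨⟨h1, h2⟩, rfl⟩ | ⟨⟨h1, h2⟩, rfl⟩ | ⟨⟨h1, h2⟩, rfl⟩)
      all_goals
        simp only [K_nil, H_nil, G_nil, numNodes_nil, numNodes_lf, numNodes_nd] at *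
        first | (split_ifs <;> omega) | grind
  rw [e, card_union_of_disjoint, card_union_of_disjoint, card_union_of_disjoint,
    card_L, card_L, card_R, card_R, Ftop hl, Htop hl, Gtop hl, H2 hl]
  · ring
  all_goals
    refine disj_nd (by simp [nil_L, nil_R]) fun A B => ?_
    simp only [mem_union, mem_L, mem_R, mem_S]
    grind [numNodes_nil, numNodes_lf, numNodes_nd]

end TreeCount

/-- the 132-avoiding permutation (as a function on ℕ) encoded by a tree -/
def pf : BT → ℕ → ℕ
  | .nil, _ => 0
  | .node _ A B, i =>
      if i < A.numNodes then pf A i + B.numNodes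
      else if i = A.numNodes then A.numNodes + B.numNodes
      else pf B (i - (A.numNodes + 1))

namespace TreePerm
open BinaryTree TreeCount

lemma pfL {A B : BT} {i : ℕ} (h : i < A.numNodes) : pf (nd A B) i = pf A i + B.numNodes := by
  simp [nd, pf, h]
lemma pfM {A B : BT} : pf (nd A B) A.numNodes = A.numNodes + B.numNodes := by
  simp [nd, pf]
lemma pfR {A B : BT} {i : ℕ} : pf (nd A B) (A.numNodes + 1 + i) = pf B i := by
  have h1 : ¬ (A.numNodes + 1 + i < A.numNodes) := by omega
  have h2 : ¬ (A.numNodes + 1 + i = A.numNodes) := by omega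
  simp [nd, pf, h1, h2]

lemma cases3 (A B : BT) {i : ℕ} (h : i < (nd A B).numNodes) :
    i < A.numNodes ∨ i = A.numNodes ∨ ∃ j, j < B.numNodes ∧ i = A.numNodes + 1 + j := by
  rw [numNodes_nd] at h
  rcases lt_trichotomy i A.numNodes with h1 | h1 | h1
  · exact Or.inl h1
  · exact Or.inr (Or.inl h1)
  · exact Or.inr (Or.inr ⟨i - (A.numNodes + 1), by omega, by omega⟩)

lemma pf_lt (t : BT) : ∀ i, i < t.numNodes → pf t i < t.numNodes := by
  induction t with
  | nil => intro i h; simp [numNodes] at h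
  | node _ A B ihA ihB =>
    change ∀ i, i < (nd A B).numNodes → pf (nd A B) i < (nd A B).numNodes
    intro i h
    rcases cases3 A B h with h1 | rfl | ⟨j, h1, rfl⟩
    · have := ihA i h1
      rw [pfL h1, numNodes_nd]; omega
    · rw [pfM, numNodes_nd]; omega
    · have := ihB j h1
      rw [pfR, numNodes_nd]; omega

lemma pf_inj (t : BT) : ∀ i j, i < t.numNodes → j < t.numNodes → pf t i = pf t j → i = j := by
  induction t with
  | nil => intro i j h; simp [numNodes] at h
  | node _ A B ihA ihB =>
    change ∀ i j, i < (nd A B).numNodes → j < (nd A B).numNodes →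
      pf (nd A B) i = pf (nd A B) j → i = j
    intro i j hi hj h
    have lA := pf_lt A
    have lB := pf_lt B
    rcases cases3 A B hi with h1 | rfl | ⟨i, h1, rfl⟩ <;>
    rcases cases3 A B hj with h2 | rfl | ⟨j, h2, rfl⟩ <;>
    simp only [pfL, pfM, pfR, *] at h <;> grind

lemma pf_avoid (t : BT) : ∀ i j k, i < j → j < k → k < t.numNodes →
    pf t i < pf t k → pf t k < pf t j → False := by
  induction t with
  | nil => intro i j k h _ h; simp [numNodes] at h
  | node _ A B ihA ihB =>
    change ∀ i j k, i < j → j < k → k < (nd A B).numNodes →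
      pf (nd A B) i < pf (nd A B) k → pf (nd A B) k < pf (nd A B) j → False
    intro i j k hij hjk hk h h'
    have lA := pf_lt A
    have lB := pf_lt B
    rcases cases3 A B (hij.trans (hjk.trans hk)) with h1 | rfl | ⟨i, h1, rfl⟩ <;>
    rcases cases3 A B (hjk.trans hk) with h2 | rfl | ⟨j, h2, rfl⟩ <;>
    rcases cases3 A B hk with h3 | rfl | ⟨k, h3, rfl⟩ <;>
    simp only [pfL, pfM, pfR, *] at h h' <;> grind

lemma pf_uniq (t : BT) : ∀ t' : BT, t.numNodes = t'.numNodes →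
    (∀ i < t.numNodes, pf t i = pf t' i) → t = t' := by
  induction t with
  | nil => intro t' h _; exact (nn_zero (h.symm)).symm
  | node _ A B ihA ihB =>
    intro t'
    cases t' with
    | nil => intro h; simp [numNodes] at h
    | node _ A' B' =>
      change (nd A B).numNodes = (nd A' B').numNodes →
        (∀ i < (nd A B).numNodes, pf (nd A B) i = pf (nd A' B') i) → nd A B = nd A' B'
      intro hn h
      have hk : A.numNodes = A'.numNodes := by
        apply pf_inj (nd A' B')
        · rw [← hn, numNodes_nd]; omega
        · rw [numNodes_nd]; omega
        · rw [pfM, ← h _ (by rw [numNodes_nd]; omega), pfM]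
          rw [numNodes_nd, numNodes_nd] at hn; omega
      rw [numNodes_nd, numNodes_nd] at hn
      have hA : A = A' := by
        apply ihA _ hk
        intro i hi
        have := h i (by rw [numNodes_nd]; omega)
        rw [pfL hi, pfL (by omega)] at this
        omega
      have hB : B = B' := by
        apply ihB _ (by omega)
        intro i hi
        have := h (A.numNodes + 1 + i) (by rw [numNodes_nd]; omega)
        rw [pfR, hk, pfR] at this
        exact this
      rw [hA, hB]

lemma pf_surj (n : ℕ) : ∀ f : ℕ → ℕ, (∀ i < n, f i < n) → (∀ i < n, ∀ j < n, f i = f j → i = j) →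
    (∀ i j k, i < j → j < k → k < n → f i < f k → f k < f j → False) →
    ∃ t : BT, t.numNodes = n ∧ ∀ i < n, pf t i = f i := by
  induction n using Nat.strong_induction_on with
  | _ n ih =>
  intro f hlt hinj hav
  rcases Nat.eq_zero_or_pos n with rfl | hn
  · exact ⟨.nil, rfl, by simp⟩
  obtain ⟨m, rfl⟩ : ∃ m, n = m + 1 := ⟨n - 1, by omega⟩
  have hsurj : ∃ k < m + 1, f k = m := by
    have h := Finset.surj_on_of_inj_on_of_card_le (s := range (m+1)) (t := range (m+1))
      (fun i _ => f i) (fun i hi => by simpa using hlt i (by simpa using hi))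
      (fun a b ha hb hab => hinj a (by simpa using ha) b (by simpa using hb) hab) le_rfl m (by simp)
    obtain ⟨k, hk, h⟩ := h
    exact ⟨k, by simpa using hk, h.symm⟩
  obtain ⟨k, hk, hfk⟩ := hsurj
  obtain ⟨r, rfl⟩ : ∃ r, m = k + r := ⟨m - k, by omega⟩
  have hmax : ∀ i < k + r + 1, i ≠ k → f i < k + r := by
    intro i hi hik
    have h1 := hlt i hi
    have h2 : f i ≠ k + r := fun h => hik (hinj i hi k hk (h.trans hfk.symm))
    omega
  have hLR : ∀ i j, i < k → j < r → f (k + 1 + j) < f i := by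
    intro i j hi hj
    by_contra hc
    have h1 : f i ≠ f (k + 1 + j) := fun h => by
      have := hinj i (by omega) _ (by omega) h
      omega
    exact hav i k (k + 1 + j) hi (by omega) (by omega) (by omega)
      (by rw [hfk]; exact hmax _ (by omega) (by omega))
  have hL : ∀ i < k, r ≤ f i := by
    intro i hi
    have := Finset.card_le_card_of_injOn (s := range r) (t := range (f i)) (fun j => f (k + 1 + j))
      (fun j hj => by simpa using hLR i j hi (by simpa using hj))
      (fun a ha b hb hab => by
        have ha' : a < r := by simpa using ha
        have hb' : b < r := by simpa using hb
        have := hinj _ (by omega) _ (by omega) hab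
        omega)
    simpa using this
  have hR : ∀ j < r, f (k + 1 + j) < r := by
    intro j hj
    have := Finset.card_le_card_of_injOn (s := range (k + 1)) (t := Ioo (f (k + 1 + j)) (k + r + 1))
      (fun i => f i)
      (fun i hi => by
        have hi' : i < k + 1 := by simpa using hi
        have h1 : f (k + 1 + j) < f i := by
          rcases Nat.lt_succ_iff_lt_or_eq.1 hi' with h | rfl
          · exact hLR i j h hj
          · rw [hfk]; exact hmax _ (by omega) (by omega)
        simpa using ⟨h1, Nat.lt_succ_iff.1 (hlt i (by omega))⟩)
      (fun a ha b hb hab => by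
        have ha' : a < k + 1 := by simpa using ha
        have hb' : b < k + 1 := by simpa using hb
        exact hinj _ (by omega) _ (by omega) hab)
    simp at this
    omega
  obtain ⟨A, hA, hAf⟩ := ih k (by omega) (fun i => f i - r)
    (fun i hi => by
      have := hL i hi
      have := hmax i (by omega) (by omega)
      show f i - r < k
      omega)
    (fun i hi j hj h => by
      have := hL i hi
      have := hL j hj
      have h' : f i - r = f j - r := h
      exact hinj i (by omega) j (by omega) (by omega))
    (fun i j l hij hjl hl h h' => by
      have h1 := hL i (by omega)
      have h2 := hL j (by omega)
      have h3 := hL l (by omega)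
      have h4 : f i - r < f l - r := h
      have h5 : f l - r < f j - r := h'
      exact hav i j l hij hjl (by omega) (by omega) (by omega))
  obtain ⟨B, hB, hBf⟩ := ih r (by omega) (fun i => f (k + 1 + i)) hR
    (fun i hi j hj h => by
      have := hinj _ (by omega) _ (by omega) h
      omega)
    (fun i j l hij hjl hl h h' =>
      hav (k + 1 + i) (k + 1 + j) (k + 1 + l) (by omega) (by omega) (by omega) h h')
  refine ⟨nd A B, by rw [numNodes_nd]; omega, fun i hi => ?_⟩
  rcases cases3 A B (i := i) (by rw [numNodes_nd]; omega) with h1 | rfl | ⟨j, h1, rfl⟩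
  · rw [pfL h1, hAf i (by omega)]
    have := hL i (by omega)
    show f i - r + _ = _
    omega
  · rw [pfM, hA, hfk, hB]
  · rw [pfR, hBf j (by omega), hA]

/-! Quadrant counts as sums -/

def UL (n : ℕ) (f : ℕ → ℕ) (i : ℕ) : ℕ := ∑ j ∈ range n, if j < i ∧ f i < f j then 1 else 0
def LL (n : ℕ) (f : ℕ → ℕ) (i : ℕ) : ℕ := ∑ j ∈ range n, if j < i ∧ f j < f i then 1 else 0
def LR (n : ℕ) (f : ℕ → ℕ) (i : ℕ) : ℕ := ∑ j ∈ range n, if i < j ∧ f j < f i then 1 else 0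

def mm (n : ℕ) (f : ℕ → ℕ) (b c d : ℕ) : ℕ :=
  ∑ i ∈ range n, if b ≤ UL n f i ∧ c ≤ LL n f i ∧ d ≤ LR n f i then 1 else 0

lemma sum_nd (A B : BT) (g : ℕ → ℕ) : ∑ i ∈ range (nd A B).numNodes, g i =
    ∑ i ∈ range A.numNodes, g i + g A.numNodes + ∑ i ∈ range B.numNodes, g (A.numNodes + 1 + i) := by
  have : (nd A B).numNodes = A.numNodes + 1 + B.numNodes := by rw [numNodes_nd]; omega
  rw [this, sum_range_add, sum_range_succ]

lemma sum_ones {n : ℕ} {p : ℕ → Prop} [DecidablePred p] (h : ∀ i < n, p i) :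
    ∑ i ∈ range n, (if p i then 1 else 0) = n := by
  rw [sum_congr rfl (g := fun _ => 1)]
  · simp
  · intro i hi; rw [if_pos (h i (by simpa using hi))]

lemma sum_zeros {n : ℕ} {p : ℕ → Prop} [DecidablePred p] (h : ∀ i < n, ¬ p i) :
    ∑ i ∈ range n, (if p i then 1 else 0) = 0 := by
  rw [sum_congr rfl (g := fun _ => 0)]
  · simp
  · intro i hi; rw [if_neg (h i (by simpa using hi))]

lemma sum_same {n : ℕ} {p q : ℕ → Prop} [DecidablePred p] [DecidablePred q]
    (h : ∀ i < n, (p i ↔ q i)) :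
    ∑ i ∈ range n, (if p i then 1 else 0) = ∑ i ∈ range n, (if q i then 1 else 0) := by
  refine sum_congr rfl fun i hi => ?_
  simp only [h i (by simpa using hi)]

section
variable {A B : BT} {i : ℕ}

lemma UL_L (h : i < A.numNodes) : UL (nd A B).numNodes (pf (nd A B)) i = UL A.numNodes (pf A) i := by
  unfold UL
  rw [sum_nd, sum_same (q := fun j => j < i ∧ pf A i < pf A j), if_neg (by omega),
    sum_zeros (n := B.numNodes)]
  · rfl
  · intro j hj; omega
  · intro j hj; rw [pfL h, pfL hj]; omega

lemma LL_L (h : i < A.numNodes) : LL (nd A B).numNodes (pf (nd A B)) i = LL A.numNodes (pf A) i := by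
  unfold LL
  rw [sum_nd, sum_same (q := fun j => j < i ∧ pf A j < pf A i), if_neg (by omega),
    sum_zeros (n := B.numNodes)]
  · rfl
  · intro j hj; omega
  · intro j hj; rw [pfL h, pfL hj]; omega

lemma LR_L (h : i < A.numNodes) : LR (nd A B).numNodes (pf (nd A B)) i =
    LR A.numNodes (pf A) i + B.numNodes := by
  unfold LR
  have := pf_lt A i h
  rw [sum_nd, sum_same (q := fun j => i < j ∧ pf A j < pf A i), if_neg,
    sum_ones (n := B.numNodes)]
  · rfl
  · intro j hj; rw [pfR, pfL h]; have := pf_lt B j hj; omega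
  · rw [pfM, pfL h]; omega
  · intro j hj; rw [pfL h, pfL hj]; omega

lemma UL_M : UL (nd A B).numNodes (pf (nd A B)) A.numNodes = 0 := by
  unfold UL
  rw [sum_nd, sum_zeros, if_neg (by omega), sum_zeros]
  · intro j hj; omega
  · intro j hj; rw [pfM, pfL hj]; have := pf_lt A j hj; omega

lemma LL_M : LL (nd A B).numNodes (pf (nd A B)) A.numNodes = A.numNodes := by
  unfold LL
  rw [sum_nd, sum_ones, if_neg (by omega), sum_zeros]
  · rfl
  · intro j hj; omega
  · intro j hj; rw [pfM, pfL hj]; have := pf_lt A j hj; omega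

lemma LR_M : LR (nd A B).numNodes (pf (nd A B)) A.numNodes = B.numNodes := by
  unfold LR
  rw [sum_nd, sum_zeros, if_neg (by omega), sum_ones]
  · omega
  · intro j hj; rw [pfM, pfR]; have := pf_lt B j hj; omega
  · intro j hj; omega

lemma UL_R (h : i < B.numNodes) : UL (nd A B).numNodes (pf (nd A B)) (A.numNodes + 1 + i) =
    A.numNodes + 1 + UL B.numNodes (pf B) i := by
  unfold UL
  have := pf_lt B i h
  rw [sum_nd, sum_ones, if_pos,
    sum_same (n := B.numNodes) (q := fun j => j < i ∧ pf B i < pf B j)]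
  · intro j hj; rw [pfR, pfR]; omega
  · rw [pfR, pfM]; omega
  · intro j hj; rw [pfR, pfL hj]; omega

lemma LL_R (h : i < B.numNodes) : LL (nd A B).numNodes (pf (nd A B)) (A.numNodes + 1 + i) =
    LL B.numNodes (pf B) i := by
  unfold LL
  have := pf_lt B i h
  rw [sum_nd, sum_zeros, if_neg,
    sum_same (n := B.numNodes) (q := fun j => j < i ∧ pf B j < pf B i)]
  · omega
  · intro j hj; rw [pfR, pfR]; omega
  · rw [pfR, pfM]; omega
  · intro j hj; rw [pfR, pfL hj]; omega

lemma LR_R : LR (nd A B).numNodes (pf (nd A B)) (A.numNodes + 1 + i) =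
    LR B.numNodes (pf B) i := by
  unfold LR
  rw [sum_nd, sum_zeros, if_neg,
    sum_same (n := B.numNodes) (q := fun j => i < j ∧ pf B j < pf B i)]
  · omega
  · intro j hj; rw [pfR, pfR]; omega
  · omega
  · intro j hj; omega
end

lemma mm_eq (t : BT) : ∀ b c d, mm t.numNodes (pf t) b c d = st t b c d := by
  induction t with
  | nil => intro b c d; simp [mm, st, numNodes]
  | node _ A B ihA ihB =>
    intro b c d
    change mm (nd A B).numNodes (pf (nd A B)) b c d = _
    rw [st, ← ihA, ← ihB]
    unfold mm
    rw [sum_nd, UL_M, LL_M, LR_M]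
    congr 1
    · congr 1
      · apply sum_same
        intro i hi
        rw [UL_L hi, LL_L hi, LR_L hi]; omega
      · simp only [Nat.le_zero]
    · apply sum_same
      intro i hi
      rw [UL_R hi, LL_R hi, LR_R]; omega

/-! Transfer to permutations -/

lemma card_fin {n : ℕ} (p : Fin n → Prop) [DecidablePred p] (q : ℕ → Prop) [DecidablePred q]
    (h : ∀ i : Fin n, p i ↔ q i) :
    #(univ.filter p) = ∑ j ∈ range n, if q j then 1 else 0 := by
  rw [card_filter, ← Fin.sum_univ_eq_sum_range (fun j => if q j then 1 else 0)]
  simp only [h]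

lemma mmp_eq {n : ℕ} (σ : Equiv.Perm (Fin n)) (f : ℕ → ℕ) (h : ∀ i : Fin n, (σ i : ℕ) = f i)
    (b c d : ℕ) : mmp 0 b c d σ = mm n f b c d := by
  unfold mmp mm
  apply card_fin
  intro i
  unfold MatchesMMP UL LL LR
  rw [card_fin (fun j => j < i ∧ σ i < σ j) (fun j => j < (i : ℕ) ∧ f i < f j),
    card_fin (fun j => j < i ∧ σ j < σ i) (fun j => j < (i : ℕ) ∧ f j < f i),
    card_fin (fun j => i < j ∧ σ j < σ i) (fun j => (i : ℕ) < j ∧ f j < f i)]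
  · simp
  all_goals intro j; simp only [Fin.lt_def, h]

/-- permutation of a tree -/
noncomputable def perm (n : ℕ) (t : BT) (ht : t.numNodes = n) : Equiv.Perm (Fin n) :=
  Equiv.ofBijective (fun i => ⟨pf t i, by have := pf_lt t i (by omega); omega⟩)
    (Finite.injective_iff_bijective.1 (fun i j h => by
      have h' : pf t i = pf t j := by simpa using h
      exact Fin.ext (pf_inj t i j (by omega) (by omega) h')))

lemma perm_apply {n : ℕ} {t : BT} (ht : t.numNodes = n) (i : Fin n) :
    (perm n t ht i : ℕ) = pf t i := rfl

lemma card_av (n b c d v : ℕ) :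
    #((Av132 n).filter (fun σ => v = mmp 0 b c d σ)) = #(S (fun t => st t b c d) n v) := by
  symm
  refine Finset.card_bij (fun t ht => perm n t (mem_S.1 ht).1) ?_ ?_ ?_
  · intro t ht
    have h := mem_S.1 ht
    simp only [Av132, mem_filter, mem_univ, true_and]
    refine ⟨?_, ?_⟩
    · rintro ⟨i, j, k, hij, hjk, h1, h2⟩
      rw [Fin.lt_def, perm_apply, perm_apply] at h1 h2
      exact pf_avoid t i j k hij hjk (by omega) h1 h2
    · rw [mmp_eq _ (pf t) (fun i => perm_apply h.1 i), ← h.2, ← mm_eq, h.1]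
  · intro t ht t' ht' h
    have h1 := mem_S.1 ht
    have h2 := mem_S.1 ht'
    refine pf_uniq t t' (by omega) fun i hi => ?_
    have := congrArg (fun σ : Equiv.Perm (Fin n) => (σ ⟨i, by omega⟩ : ℕ)) h
    simpa only [perm_apply] using this
  · intro σ hσ
    simp only [Av132, mem_filter, mem_univ, true_and] at hσ
    obtain ⟨hav, hv⟩ := hσ
    obtain ⟨t, ht, hf⟩ := pf_surj n (fun i => if h : i < n then (σ ⟨i, h⟩ : ℕ) else 0)
      (fun i hi => by simp [hi])
      (fun i hi j hj h => by
        simp only [hi, hj, dif_pos] at h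
        simpa using σ.injective (Fin.ext h))
      (fun i j k hij hjk hk h1 h2 => by
        simp only [hk, hjk.trans hk, hij.trans (hjk.trans hk), dif_pos] at h1 h2
        exact hav ⟨⟨i, by omega⟩, ⟨j, by omega⟩, ⟨k, hk⟩, hij, hjk, h1, h2⟩)
    have hσt : ∀ i : Fin n, (σ i : ℕ) = pf t i := by
      intro i; rw [hf i i.2]; simp
    refine ⟨t, ?_, ?_⟩
    · rw [mem_S]
      exact ⟨ht, by rw [hv, mmp_eq σ (pf t) hσt, ← ht, mm_eq]⟩
    · ext i
      rw [perm_apply, hσt]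

end TreePerm

/-- for `ℓ ≥ 2` and `n ≥ 4 + ℓ`, the coefficient of `x^{n-3-ℓ}` in
`Q_{n,132}^{(0,1,ℓ,1)}(x)` equals `C_{ℓ+1} + 6·C_ℓ + 2·C_ℓ·(n-4-ℓ)`. -/
theorem stmt11 (l n : ℕ) (hl : 2 ≤ l) (hn : 4 + l ≤ n) :
    (Q n 0 1 l 1).coeff (n - 3 - l) =
      ((catalan (l + 1) + 6 * catalan l
        + 2 * catalan l * (n - 4 - l) : ℕ) : ℤ) := by
  obtain ⟨j, rfl⟩ : ∃ j, n = l + 4 + j := ⟨n - (l + 4), by omega⟩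
  have e1 : l + 4 + j - 3 - l = j + 1 := by omega
  have e2 : l + 4 + j - 4 - l = j := by omega
  rw [e1, e2, ← TreeCount.F2 hl j]
  unfold Q
  rw [Polynomial.finsetSum_coeff]
  simp only [Polynomial.coeff_X_pow]
  rw [Finset.sum_boole, TreePerm.card_av]
  rfl
end

section
/- For all n ≥ 2, the number of 132-avoiding permutations σ of {1,…,n} with mmp^{(0,1,1,1)}(σ) = 0 (i.e., the constant term Q_{n,132}^{(0,1,1,1)}(0)) equals (n-1)·2^{n-2} + 1. -/
open Finset Polynomial

open Classical in
/-- A property of every splitting of the list. -/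
def AllSplit (φ : List ℕ → ℕ → List ℕ → Prop) (l : List ℕ) : Prop :=
  ∀ P x S, l = P ++ x :: S → φ P x S

theorem allSplit_nil (φ) : AllSplit φ [] := by
  intro P x S h; simp at h

theorem allSplit_mid (φ : List ℕ → ℕ → List ℕ → Prop) (A : List ℕ) (M : ℕ) (B : List ℕ) :
    AllSplit φ (A ++ M :: B) ↔ AllSplit (fun P x S => φ P x (S ++ M :: B)) A ∧ φ A M B ∧
      AllSplit (fun P x S => φ (A ++ M :: P) x S) B := by
  constructor
  · intro h
    refine ⟨?_, h _ _ _ rfl, ?_⟩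
    · rintro P x S rfl
      exact h _ _ _ (by simp)
    · rintro P x S rfl
      exact h _ _ _ (by simp)
  · rintro ⟨h1, h2, h3⟩ P x S h
    rcases List.append_eq_append_iff.1 h with ⟨T, hP, hT⟩ | ⟨T, hA, hT⟩
    · cases T with
      | nil => simp at hP hT; obtain ⟨rfl, rfl⟩ := hT; subst hP; exact h2
      | cons y T =>
        simp at hT; obtain ⟨rfl, hT⟩ := hT
        subst hP
        exact h3 _ _ _ hT
    · cases T with
      | nil => simp at hA hT; obtain ⟨rfl, rfl⟩ := hT; subst hA; exact h2
      | cons y T =>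
        simp at hT; obtain ⟨rfl, rfl⟩ := hT
        exact h1 _ _ _ hA

theorem allSplit_congr {φ ψ : List ℕ → ℕ → List ℕ → Prop} {l : List ℕ}
    (h : ∀ P x S, (∀ y ∈ P, y ∈ l) → x ∈ l → (∀ y ∈ S, y ∈ l) → (φ P x S ↔ ψ P x S)) :
    AllSplit φ l ↔ AllSplit ψ l := by
  constructor
  · rintro h1 P x S rfl
    exact (h P x S (by simp +contextual) (by simp) (by simp +contextual)).1 (h1 _ _ _ rfl)
  · rintro h1 P x S rfl
    exact (h P x S (by simp +contextual) (by simp) (by simp +contextual)).2 (h1 _ _ _ rfl)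

def LAv : List ℕ → Prop := AllSplit (fun P x S => ∀ a ∈ P, ∀ c ∈ S, ¬ (a < c ∧ c < x))
def L111 : List ℕ → Prop := AllSplit (fun P x S =>
  ¬ ((∃ y ∈ P, x < y) ∧ (∃ z ∈ P, z < x) ∧ (∃ w ∈ S, w < x)))
def L110 : List ℕ → Prop := AllSplit (fun P x _ => ¬ ((∃ y ∈ P, x < y) ∧ (∃ z ∈ P, z < x)))
def L011 : List ℕ → Prop := AllSplit (fun P x S => ¬ ((∃ z ∈ P, z < x) ∧ (∃ w ∈ S, w < x)))
def L010 : List ℕ → Prop := AllSplit (fun P x _ => ¬ (∃ z ∈ P, z < x))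

open Classical in
/-- 132-avoiding words on the letters `s, ..., s+n-1`. -/
noncomputable def LX (s n : ℕ) : Finset (List ℕ) :=
  (List.range' s n).permutations.toFinset.filter LAv

theorem mem_LX {s n : ℕ} {l : List ℕ} :
    l ∈ LX s n ↔ (l.Nodup ∧ ∀ x, x ∈ l ↔ s ≤ x ∧ x < s + n) ∧ LAv l := by
  unfold LX
  simp only [Finset.mem_filter, List.mem_toFinset, List.mem_permutations]
  refine and_congr_left' ?_
  constructor
  · intro h
    exact ⟨h.nodup_iff.2 List.nodup_range', fun x => by rw [h.mem_iff, List.mem_range'_1]⟩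
  · rintro ⟨h1, h2⟩
    rw [List.perm_ext_iff_of_nodup h1 List.nodup_range']
    intro x; rw [h2, List.mem_range'_1]

theorem length_LX {s n : ℕ} {l : List ℕ} (h : l ∈ LX s n) : l.length = n := by
  unfold LX at h
  simp only [Finset.mem_filter, List.mem_toFinset, List.mem_permutations] at h
  simpa using h.1.length_eq

theorem LX_zero (s : ℕ) : LX s 0 = {[]} := by
  ext l
  rw [Finset.mem_singleton]
  constructor
  · intro h; simpa using length_LX h
  · rintro rfl
    rw [mem_LX]
    exact ⟨⟨by simp, by simp⟩, allSplit_nil _⟩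

theorem mid_mem_LX {s k m : ℕ} {A B : List ℕ} (hA : A ∈ LX (s + m) k) (hB : B ∈ LX s m) :
    A ++ (s + (k + m)) :: B ∈ LX s (k + m + 1) := by
  rw [mem_LX] at *
  obtain ⟨⟨a1, a2⟩, a3⟩ := hA
  obtain ⟨⟨b1, b2⟩, b3⟩ := hB
  refine ⟨⟨?_, ?_⟩, ?_⟩
  · rw [List.nodup_append, List.nodup_cons]
    refine ⟨a1, ⟨?_, b1⟩, ?_⟩
    · rw [b2]; omega
    · intro a ha b hb
      rw [a2] at ha
      rw [List.mem_cons, b2] at hb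
      omega
  · intro x
    rw [List.mem_append, List.mem_cons, a2, b2]; omega
  · unfold LAv at *
    rw [allSplit_mid]
    refine ⟨?_, ?_, ?_⟩
    · refine (allSplit_congr ?_).1 a3
      intro P x S hP hx hS
      constructor
      · intro h a ha c hc
        rw [List.mem_append, List.mem_cons] at hc
        have := (a2 _).1 (hP a ha)
        have := (a2 _).1 hx
        rcases hc with hc | hc | hc
        · exact h a ha c hc
        · omega
        · rw [b2] at hc; omega
      · intro h a ha c hc
        exact h a ha c (by simp [hc])
    · intro a ha c hc
      rw [a2] at ha; rw [b2] at hc; omega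
    · refine (allSplit_congr ?_).1 b3
      intro P x S hP hx hS
      constructor
      · intro h a ha c hc
        rw [List.mem_append, List.mem_cons] at ha
        have := (b2 _).1 (hS c hc)
        have := (b2 _).1 hx
        rcases ha with ha | ha | ha
        · rw [a2] at ha; omega
        · omega
        · exact h a ha c hc
      · intro h a ha c hc
        exact h a (by simp [ha]) c hc

theorem exists_mid {s n : ℕ} {l : List ℕ} (h : l ∈ LX s (n + 1)) :
    ∃ k m A B, k + m = n ∧ A ∈ LX (s + m) k ∧ B ∈ LX s m ∧ l = A ++ (s + n) :: B := by
  have hlen := length_LX h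
  rw [mem_LX] at h
  obtain ⟨⟨h1, h2⟩, h3⟩ := h
  obtain ⟨A, B, rfl⟩ := List.append_of_mem ((h2 (s + n)).2 (by omega))
  unfold LAv at h3
  rw [allSplit_mid] at h3
  obtain ⟨u1, u2, u3⟩ := h3
  rw [List.nodup_append, List.nodup_cons] at h1
  obtain ⟨n1, ⟨n2, n3⟩, n4⟩ := h1
  have hA : ∀ a ∈ A, s ≤ a ∧ a < s + n := by
    intro a ha
    have := (h2 a).1 (by simp [ha])
    have := n4 a ha (s + n) (by simp)
    omega
  have hB : ∀ a ∈ B, s ≤ a ∧ a < s + n := by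
    intro a ha
    have := (h2 a).1 (by simp [ha])
    have : a ≠ s + n := by rintro rfl; exact n2 ha
    omega
  have hAB : ∀ a ∈ A, ∀ b ∈ B, b < a := by
    intro a ha b hb
    have := u2 a ha b hb
    have := hB b hb
    have := n4 a ha b (by simp [hb])
    omega
  have hB' : B.toFinset = Finset.Ico s (s + B.length) := by
    apply Finset.eq_of_subset_of_card_le
    · intro c hc
      rw [List.mem_toFinset] at hc
      have hsub : Finset.Ico s (c + 1) ⊆ B.toFinset := by
        intro x hx
        rw [Finset.mem_Ico] at hx
        rw [List.mem_toFinset]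
        have hc' := hB c hc
        have := (h2 x).2 (by omega)
        rw [List.mem_append, List.mem_cons] at this
        rcases this with hh | hh | hh
        · have := hAB x hh c hc; omega
        · omega
        · exact hh
      have := Finset.card_le_card hsub
      rw [List.toFinset_card_of_nodup n3, Nat.card_Ico] at this
      have := hB c hc
      rw [Finset.mem_Ico]; omega
    · rw [List.toFinset_card_of_nodup n3, Nat.card_Ico]; omega
  have hBm : ∀ x, x ∈ B ↔ s ≤ x ∧ x < s + B.length := by
    intro x
    rw [← List.mem_toFinset, hB', Finset.mem_Ico]
  have hl : A.length + B.length = n := by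
    simp at hlen; omega
  refine ⟨A.length, B.length, A, B, hl, ?_, ?_, rfl⟩
  · rw [mem_LX]
    refine ⟨⟨n1, ?_⟩, ?_⟩
    · intro x
      constructor
      · intro hx
        have h4 := hA x hx
        have h5 : ¬ x ∈ B := fun hb => by have := hAB x hx x hb; omega
        rw [hBm] at h5; omega
      · intro hx
        have := (h2 x).2 (by omega)
        rw [List.mem_append, List.mem_cons, hBm] at this
        rcases this with hh | hh | hh
        · exact hh
        · omega
        · omega
    · intro P x S hh a ha c hc
      exact u1 P x S hh a ha c (by simp [hc])
  · rw [mem_LX]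
    refine ⟨⟨n3, hBm⟩, ?_⟩
    intro P x S hh a ha c hc
    exact u3 P x S hh a (by simp [ha]) c hc

open Classical in
theorem card_rec (p : List ℕ → Prop) (s n : ℕ) :
    ((LX s (n + 1)).filter p).card = ∑ km ∈ Finset.HasAntidiagonal.antidiagonal n,
      ((LX (s + km.2) km.1 ×ˢ LX s km.2).filter
        (fun AB => p (AB.1 ++ (s + n) :: AB.2))).card := by
  have e : (LX s (n + 1)).filter p = (Finset.HasAntidiagonal.antidiagonal n).biUnion (fun km =>
      ((LX (s + km.2) km.1 ×ˢ LX s km.2).filter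
        (fun AB => p (AB.1 ++ (s + n) :: AB.2))).image (fun AB => AB.1 ++ (s + n) :: AB.2)) := by
    ext l
    simp only [Finset.mem_filter, Finset.mem_biUnion, Finset.mem_image, Finset.mem_product,
      Finset.HasAntidiagonal.mem_antidiagonal]
    constructor
    · rintro ⟨h, hp⟩
      obtain ⟨k, m, A, B, e, hA, hB, rfl⟩ := exists_mid h
      exact ⟨(k, m), e, (A, B), ⟨⟨hA, hB⟩, hp⟩, rfl⟩
    · rintro ⟨⟨k, m⟩, rfl, ⟨A, B⟩, ⟨⟨hA, hB⟩, hp⟩, rfl⟩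
      exact ⟨mid_mem_LX hA hB, hp⟩
  rw [e, Finset.card_biUnion]
  · refine Finset.sum_congr rfl fun km _ => ?_
    apply Finset.card_image_of_injOn
    rintro ⟨A, B⟩ h1 ⟨A', B'⟩ h2 h
    simp only [Finset.coe_filter, Finset.mem_product, Set.mem_ofPred_eq] at h1 h2 h
    have := List.append_inj h (by rw [length_LX h1.1.1, length_LX h2.1.1])
    simp at this
    simp [this]
  · rintro ⟨k, m⟩ h1 ⟨k', m'⟩ h2 hne
    rw [Function.onFun, Finset.disjoint_left]
    intro l hl hl'
    simp only [Finset.mem_filter, Finset.mem_image, Finset.mem_product] at hl hl'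
    obtain ⟨⟨A, B⟩, ⟨⟨a1, a2⟩, -⟩, rfl⟩ := hl
    obtain ⟨⟨A', B'⟩, ⟨⟨b1, b2⟩, b3⟩, h⟩ := hl'
    have n1 := a1
    have n2 := b1
    rw [Finset.mem_coe, Finset.HasAntidiagonal.mem_antidiagonal] at h1 h2
    simp only at *
    apply hne
    have ha : s + n ∉ A := by
      rw [mem_LX] at a1; rw [a1.1.2]; omega
    have ha' : s + n ∉ A' := by
      rw [mem_LX] at b1; rw [b1.1.2]; omega
    have hb : s + n ∉ B := by
      rw [mem_LX] at a2; rw [a2.1.2]; omega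
    have hb' : s + n ∉ B' := by
      rw [mem_LX] at b2; rw [b2.1.2]; omega
    have hlenA : A.length = A'.length := by
      have := congrArg (List.idxOf (s + n)) h
      rw [List.idxOf_append_of_notMem ha, List.idxOf_append_of_notMem ha'] at this
      simp at this
      exact this.symm
    rw [length_LX n1, length_LX n2] at hlenA
    simp only [Prod.mk.injEq]; omega

theorem ne_nil_LX {s n : ℕ} {l : List ℕ} (h : l ∈ LX s n) : l = [] ↔ n = 0 := by
  rw [← List.length_eq_zero_iff, length_LX h]

theorem L010_mid {s k m : ℕ} {A B : List ℕ} (hA : A ∈ LX (s + m) k) (hB : B ∈ LX s m) :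
    L010 (A ++ (s + (k + m)) :: B) ↔ A = [] ∧ L010 B := by
  rw [mem_LX] at hA hB
  obtain ⟨⟨a1, a2⟩, a3⟩ := hA
  obtain ⟨⟨b1, b2⟩, b3⟩ := hB
  unfold L010
  rw [allSplit_mid]
  constructor
  · rintro ⟨-, h2, h3⟩
    refine ⟨?_, fun P x S e ⟨z, hz, hzx⟩ => h3 P x S e ⟨z, by simp [hz], hzx⟩⟩
    rw [List.eq_nil_iff_forall_not_mem]
    intro a ha
    exact h2 ⟨a, ha, by rw [a2] at ha; omega⟩
  · rintro ⟨rfl, h⟩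
    refine ⟨allSplit_nil _, by simp, ?_⟩
    rintro P x S rfl ⟨z, hz, hzx⟩
    have hx := (b2 x).1 (by simp)
    simp at hz
    rcases hz with hz | hz
    · omega
    · exact h P x S rfl ⟨z, hz, hzx⟩

theorem L110_mid {s k m : ℕ} {A B : List ℕ} (hA : A ∈ LX (s + m) k) (hB : B ∈ LX s m) :
    L110 (A ++ (s + (k + m)) :: B) ↔ L110 A ∧ L010 B := by
  rw [mem_LX] at hA hB
  obtain ⟨⟨a1, a2⟩, a3⟩ := hA
  obtain ⟨⟨b1, b2⟩, b3⟩ := hB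
  unfold L010 L110
  rw [allSplit_mid]
  constructor
  · rintro ⟨h1, h2, h3⟩
    refine ⟨h1, ?_⟩
    rintro P x S rfl ⟨z, hz, hzx⟩
    have hx := (b2 x).1 (by simp)
    exact h3 P x S rfl ⟨⟨s + (k + m), by simp, by omega⟩, ⟨z, by simp [hz], hzx⟩⟩
  · rintro ⟨h1, h2⟩
    refine ⟨h1, ?_, ?_⟩
    · rintro ⟨⟨y, hy, hy'⟩, -⟩
      rw [a2] at hy; omega
    · rintro P x S rfl ⟨-, z, hz, hzx⟩
      have hx := (b2 x).1 (by simp)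
      rw [List.mem_append, List.mem_cons, a2] at hz
      rcases hz with hz | hz | hz
      · omega
      · omega
      · exact h2 P x S rfl ⟨z, hz, hzx⟩

theorem L011_B {s k m : ℕ} {A B : List ℕ} (hA : A ∈ LX (s + m) k) (hB : B ∈ LX s m) :
    AllSplit (fun P x S => ¬ ((∃ z ∈ A ++ (s + (k + m)) :: P, z < x) ∧ (∃ w ∈ S, w < x))) B
      ↔ L011 B := by
  rw [mem_LX] at hA hB
  obtain ⟨⟨a1, a2⟩, a3⟩ := hA
  obtain ⟨⟨b1, b2⟩, b3⟩ := hB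
  apply allSplit_congr
  intro P x S hP hx hS
  rw [b2] at hx
  have : (∃ z ∈ A ++ (s + (k + m)) :: P, z < x) ↔ ∃ z ∈ P, z < x := by
    constructor
    · rintro ⟨z, hz, hzx⟩
      rw [List.mem_append, List.mem_cons, a2] at hz
      rcases hz with hz | hz | hz
      · omega
      · omega
      · exact ⟨z, hz, hzx⟩
    · rintro ⟨z, hz, hzx⟩
      exact ⟨z, by simp [hz], hzx⟩
  rw [this]

theorem L011_mid {s k m : ℕ} {A B : List ℕ} (hA : A ∈ LX (s + m) k) (hB : B ∈ LX s m) :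
    L011 (A ++ (s + (k + m)) :: B) ↔ (L011 A ∧ (k = 0 ∨ m = 0)) ∧ L011 B := by
  have hBB := L011_B hA hB
  rw [← ne_nil_LX hA, ← ne_nil_LX hB]
  rw [mem_LX] at hA hB
  obtain ⟨⟨a1, a2⟩, a3⟩ := hA
  obtain ⟨⟨b1, b2⟩, b3⟩ := hB
  rw [← hBB]
  unfold L011
  rw [allSplit_mid]
  constructor
  · rintro ⟨h1, h2, h3⟩
    refine ⟨⟨?_, ?_⟩, h3⟩
    · rintro P x S rfl ⟨hz, w, hw, hwx⟩
      exact h1 P x S rfl ⟨hz, w, by simp [hw], hwx⟩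
    · by_contra hc
      push Not at hc
      obtain ⟨a, ha⟩ := List.exists_mem_of_ne_nil _ hc.1
      obtain ⟨b, hb⟩ := List.exists_mem_of_ne_nil _ hc.2
      refine h2 ⟨⟨a, ha, ?_⟩, ⟨b, hb, ?_⟩⟩
      · rw [a2] at ha; omega
      · rw [b2] at hb; omega
  · rintro ⟨⟨h1, h2⟩, h3⟩
    refine ⟨?_, ?_, h3⟩
    · rcases h2 with rfl | rfl
      · exact allSplit_nil _
      · rintro P x S rfl ⟨hz, w, hw, hwx⟩
        have hx := (a2 x).1 (by simp)
        simp at hw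
        rcases hw with hw | hw
        · exact h1 P x S rfl ⟨hz, w, hw, hwx⟩
        · omega
    · rcases h2 with rfl | rfl <;> simp

theorem L111_mid_zero {s k : ℕ} {A B : List ℕ} (hA : A ∈ LX (s + 0) k) (hB : B ∈ LX s 0) :
    L111 (A ++ (s + (k + 0)) :: B) ↔ L111 A ∧ True := by
  have : B = [] := (ne_nil_LX hB).2 rfl
  subst this
  rw [mem_LX] at hA
  obtain ⟨⟨a1, a2⟩, a3⟩ := hA
  unfold L111
  rw [allSplit_mid]
  constructor
  · rintro ⟨h1, -, -⟩
    refine ⟨?_, trivial⟩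
    rintro P x S rfl ⟨hy, hz, w, hw, hwx⟩
    exact h1 P x S rfl ⟨hy, hz, w, by simp [hw], hwx⟩
  · rintro ⟨h1, -⟩
    refine ⟨?_, by simp, allSplit_nil _⟩
    rintro P x S rfl ⟨hy, hz, w, hw, hwx⟩
    have hx := (a2 x).1 (by simp)
    simp at hw
    rcases hw with hw | hw
    · exact h1 P x S rfl ⟨hy, hz, w, hw, hwx⟩
    · omega

theorem L111_mid {s k m : ℕ} (hm : m ≠ 0) {A B : List ℕ} (hA : A ∈ LX (s + m) k)
    (hB : B ∈ LX s m) :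
    L111 (A ++ (s + (k + m)) :: B) ↔ L110 A ∧ L011 B := by
  have hBB := L011_B hA hB
  have hne : B ≠ [] := by rwa [Ne, ne_nil_LX hB]
  obtain ⟨b, hb⟩ := List.exists_mem_of_ne_nil _ hne
  rw [mem_LX] at hA hB
  obtain ⟨⟨a1, a2⟩, a3⟩ := hA
  obtain ⟨⟨b1, b2⟩, b3⟩ := hB
  rw [← hBB]
  unfold L111 L110
  rw [allSplit_mid]
  constructor
  · rintro ⟨h1, h2, h3⟩
    refine ⟨?_, ?_⟩
    · rintro P x S rfl ⟨hy, hz⟩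
      have hx := (a2 x).1 (by simp)
      refine h1 P x S rfl ⟨hy, hz, b, by simp [hb], ?_⟩
      rw [b2] at hb; omega
    · rintro P x S rfl ⟨hz, hw⟩
      have hx := (b2 x).1 (by simp)
      exact h3 P x S rfl ⟨⟨s + (k + m), by simp, by omega⟩, hz, hw⟩
  · rintro ⟨h1, h2⟩
    refine ⟨?_, ?_, ?_⟩
    · rintro P x S rfl ⟨hy, hz, hw⟩
      exact h1 P x S rfl ⟨hy, hz⟩
    · rintro ⟨⟨y, hy, hy'⟩, -⟩
      rw [a2] at hy; omega
    · rintro P x S rfl ⟨hy, hz, hw⟩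
      exact h2 P x S rfl ⟨hz, hw⟩

open Classical in
theorem card_prod_iff (X Y : Finset (List ℕ)) (r : List ℕ × List ℕ → Prop) (p q : List ℕ → Prop)
    (h : ∀ A ∈ X, ∀ B ∈ Y, r (A, B) ↔ p A ∧ q B) :
    ((X ×ˢ Y).filter r).card = (X.filter p).card * (Y.filter q).card := by
  rw [← Finset.card_product, ← Finset.filter_product]
  congr 1
  apply Finset.filter_congr
  rintro ⟨A, B⟩ hAB
  rw [Finset.mem_product] at hAB
  exact h A hAB.1 B hAB.2

/-- Number of words in `LX s n` with property `p`. -/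
noncomputable def cnt (p : List ℕ → Prop) (s n : ℕ) : ℕ := by
  classical exact ((LX s n).filter p).card

theorem cnt_rec (p : List ℕ → Prop) (s n : ℕ) (g : ℕ → ℕ → ℕ)
    (hg : ∀ k m, k + m = n → ∃ q r : List ℕ → Prop,
      (∀ A ∈ LX (s + m) k, ∀ B ∈ LX s m, p (A ++ (s + (k + m)) :: B) ↔ q A ∧ r B) ∧
        cnt q (s + m) k * cnt r s m = g k m) :
    cnt p s (n + 1) = ∑ k ∈ Finset.range (n + 1), g k (n - k) := by
  unfold cnt at hg ⊢
  rw [card_rec, ← Finset.Nat.sum_antidiagonal_eq_sum_range_succ g]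
  refine Finset.sum_congr rfl ?_
  rintro ⟨k, m⟩ hkm
  rw [Finset.HasAntidiagonal.mem_antidiagonal] at hkm
  obtain ⟨q, r, h1, h2⟩ := hg k m hkm
  rw [← h2]
  simp only at hkm
  subst hkm
  exact card_prod_iff _ _ _ q r h1

open Classical in
theorem cnt_zero (p : List ℕ → Prop) (hp : p []) (s : ℕ) : cnt p s 0 = 1 := by
  unfold cnt
  rw [LX_zero, Finset.filter_singleton, if_pos hp, Finset.card_singleton]

open Classical in
theorem cnt_false (p : List ℕ → Prop) (s n : ℕ) (h : ∀ l ∈ LX s n, ¬ p l) : cnt p s n = 0 := by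
  unfold cnt
  rw [Finset.card_eq_zero, Finset.filter_eq_empty_iff]
  exact fun l hl => h l hl

theorem cnt_L010 (s n : ℕ) : cnt L010 s n = 1 := by
  induction n generalizing s with
  | zero => exact cnt_zero _ (allSplit_nil _) _
  | succ n ih =>
    rw [cnt_rec L010 s n (fun k _ => if k = 0 then 1 else 0)]
    · simp
    · rintro k m rfl
      refine ⟨fun A => A = [], L010, fun A hA B hB => L010_mid hA hB, ?_⟩
      split_ifs with hk
      · subst hk
        rw [cnt_zero (fun A => A = []) rfl]
        simp at ih
        rw [ih]
      · rw [cnt_false, zero_mul]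
        intro l hl
        rwa [ne_nil_LX hl]

/-- `1, 1, 2, 4, 8, ...` -/
def pw (n : ℕ) : ℕ := if n = 0 then 1 else 2 ^ (n - 1)

theorem sum_pw (n : ℕ) : ∑ k ∈ Finset.range (n + 1), pw k = 2 ^ n := by
  induction n with
  | zero => simp [pw]
  | succ n ih => rw [Finset.sum_range_succ, ih]; simp [pw]; ring

theorem sum_pw_mul (n : ℕ) :
    2 * ∑ k ∈ Finset.range (n + 1), pw k * pw (n + 1 - k) = 2 ^ n * (n + 2) := by
  rw [Finset.sum_range_succ']
  cases n with
  | zero => simp [pw]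
  | succ n =>
    rw [Finset.sum_congr rfl (g := fun _ => 2 ^ n)]
    · simp [pw]; ring
    · intro k hk
      rw [Finset.mem_range] at hk
      have : n + 1 + 1 - (k + 1) ≠ 0 := by omega
      simp only [pw, this, if_false, Nat.add_eq_zero_iff, one_ne_zero, and_false]
      rw [← pow_add]
      congr 1; omega

theorem cnt_L110 (s n : ℕ) : cnt L110 s n = pw n := by
  induction n using Nat.strong_induction_on generalizing s with
  | _ n ih =>
    cases n with
    | zero => exact cnt_zero _ (allSplit_nil _) _
    | succ n =>
      rw [cnt_rec L110 s n (fun k _ => pw k), sum_pw]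
      · simp [pw]
      · rintro k m rfl
        refine ⟨L110, L010, fun A hA B hB => L110_mid hA hB, ?_⟩
        rw [ih k (by omega), cnt_L010, mul_one]

theorem cnt_L011 (s n : ℕ) : cnt L011 s n = pw n := by
  induction n using Nat.strong_induction_on generalizing s with
  | _ n ih =>
    cases n with
    | zero => exact cnt_zero _ (allSplit_nil _) _
    | succ n =>
      rw [cnt_rec L011 s n (fun k m => if k = 0 ∨ m = 0 then pw k * pw m else 0)]
      · cases n with
        | zero => simp [pw]
        | succ n =>
          rw [Finset.sum_range_succ, Finset.sum_range_succ', Finset.sum_eq_zero]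
          · simp [pw]; ring
          · intro k hk
            rw [Finset.mem_range] at hk
            rw [if_neg]; omega
      · rintro k m rfl
        refine ⟨fun A => L011 A ∧ (k = 0 ∨ m = 0), L011, fun A hA B hB => L011_mid hA hB, ?_⟩
        split_ifs with h
        · simp only [h, and_true]
          rw [← ih k (by omega) (s + m), ← ih m (by omega) s]
        · rw [cnt_false, zero_mul]
          tauto

theorem cnt_true_zero (s : ℕ) : cnt (fun _ => True) s 0 = 1 := cnt_zero _ trivial _

theorem cnt_L111 (s n : ℕ) : cnt L111 s (n + 1) = n * 2 ^ (n - 1) + 1 := by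
  induction n generalizing s with
  | zero =>
    rw [cnt_rec L111 s 0 (fun _ _ => 1)]
    · simp
    · intro k m h
      obtain ⟨rfl, rfl⟩ : k = 0 ∧ m = 0 := by omega
      refine ⟨L111, fun _ => True, fun A hA B hB => L111_mid_zero hA hB, ?_⟩
      rw [cnt_true_zero, cnt_zero L111 (allSplit_nil _)]
  | succ n ih =>
    rw [cnt_rec L111 s (n + 1) (fun k m => if m = 0 then n * 2 ^ (n - 1) + 1 else pw k * pw m)]
    · rw [Finset.sum_range_succ, Finset.sum_congr rfl (g := fun k => pw k * pw (n + 1 - k))]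
      · have := sum_pw_mul n
        cases n with
        | zero => simp at this ⊢; omega
        | succ n =>
          simp at this ⊢
          ring_nf at this ⊢
          omega
      · intro k hk
        rw [Finset.mem_range] at hk
        rw [if_neg]; omega
    · intro k m h
      split_ifs with hm
      · subst hm
        simp at h
        subst h
        refine ⟨L111, fun _ => True, fun A hA B hB => L111_mid_zero hA hB, ?_⟩
        rw [cnt_true_zero, ih, mul_one]
      · refine ⟨L110, L011, fun A hA B hB => L111_mid hm hA hB, ?_⟩
        rw [cnt_L110, cnt_L011]

theorem allSplit_ofFn {n : ℕ} (f : Fin n → ℕ) (φ : List ℕ → ℕ → List ℕ → Prop) :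
    AllSplit φ (List.ofFn f) ↔
      ∀ i : Fin n, φ ((List.ofFn f).take i) (f i) ((List.ofFn f).drop (i + 1)) := by
  constructor
  · intro h i
    apply h
    conv_lhs => rw [← List.take_append_drop i (List.ofFn f)]
    rw [List.drop_eq_getElem_cons (by simp)]
    simp
  · intro h P x S e
    have hl := congrArg List.length e
    simp at hl
    have := h ⟨P.length, by omega⟩
    have hx : f ⟨P.length, by omega⟩ = (List.ofFn f)[P.length]'(by simp; omega) := by simp
    rw [hx] at this
    simpa [e] using this

theorem mem_take_ofFn {n : ℕ} (f : Fin n → ℕ) (i : Fin n) (a : ℕ) :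
    a ∈ (List.ofFn f).take i ↔ ∃ j, j < i ∧ f j = a := by
  rw [List.mem_take_iff_getElem]
  constructor
  · rintro ⟨j, hj, rfl⟩
    simp at hj
    exact ⟨⟨j, by omega⟩, by rw [Fin.lt_def]; simp; omega, by simp⟩
  · rintro ⟨j, hj, rfl⟩
    exact ⟨j, by simp; omega, by simp⟩

theorem mem_drop_ofFn {n : ℕ} (f : Fin n → ℕ) (i : Fin n) (a : ℕ) :
    a ∈ (List.ofFn f).drop (i + 1) ↔ ∃ j, i < j ∧ f j = a := by
  rw [List.mem_drop_iff_getElem]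
  constructor
  · rintro ⟨j, hj, rfl⟩
    simp at hj
    exact ⟨⟨i + 1 + j, by omega⟩, by rw [Fin.lt_def]; simp; omega, by simp⟩
  · rintro ⟨j, hj, rfl⟩
    rw [Fin.lt_def] at hj
    refine ⟨j - (i + 1), by simp; omega, ?_⟩
    simp only [List.getElem_ofFn]
    congr 1
    ext; simp; omega

theorem LAv_ofFn {n : ℕ} (σ : Equiv.Perm (Fin n)) :
    LAv (List.ofFn fun i => (σ i : ℕ)) ↔ Avoids132 σ := by
  unfold LAv Avoids132
  rw [allSplit_ofFn]
  simp only [mem_take_ofFn, mem_drop_ofFn]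
  constructor
  · rintro h ⟨i, j, k, h1, h2, h3, h4⟩
    exact h j _ ⟨i, h1, rfl⟩ _ ⟨k, h2, rfl⟩ ⟨h3, h4⟩
  · rintro h j _ ⟨i, h1, rfl⟩ _ ⟨k, h2, rfl⟩ ⟨h3, h4⟩
    exact h ⟨i, j, k, h1, h2, h3, h4⟩

theorem L111_ofFn {n : ℕ} (σ : Equiv.Perm (Fin n)) :
    L111 (List.ofFn fun i => (σ i : ℕ)) ↔ mmp 0 1 1 1 σ = 0 := by
  unfold L111 mmp
  rw [allSplit_ofFn, Finset.card_eq_zero, Finset.filter_eq_empty_iff]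
  simp only [mem_take_ofFn, mem_drop_ofFn]
  refine forall_congr' fun i => ?_
  simp only [Finset.mem_univ, true_implies]
  refine not_congr ?_
  unfold MatchesMMP
  simp only [Nat.zero_le, true_and, Nat.one_le_iff_ne_zero, Finset.card_ne_zero,
    Finset.Nonempty, Finset.mem_filter, Finset.mem_univ]
  refine and_congr ?_ (and_congr ?_ ?_)
  all_goals
    constructor
    · rintro ⟨_, ⟨j, hj, rfl⟩, h⟩
      exact ⟨j, hj, h⟩
    · rintro ⟨j, hj, h⟩
      exact ⟨_, ⟨j, hj, rfl⟩, h⟩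

theorem card_eq_cnt (n : ℕ) :
    ((Av132 n).filter (fun σ => mmp 0 1 1 1 σ = 0)).card = cnt L111 0 n := by
  classical
  unfold cnt
  apply Finset.card_bij (fun σ _ => List.ofFn fun i => (σ i : ℕ))
  · intro σ hσ
    simp only [Av132, Finset.mem_filter, Finset.mem_univ, true_and] at hσ
    rw [Finset.mem_filter, mem_LX, LAv_ofFn, L111_ofFn]
    refine ⟨⟨⟨?_, ?_⟩, hσ.1⟩, hσ.2⟩
    · rw [List.nodup_ofFn]
      intro i j h
      exact σ.injective (Fin.ext h)
    · intro x
      rw [List.mem_ofFn]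
      constructor
      · rintro ⟨i, rfl⟩
        simp
      · rintro ⟨-, h⟩
        exact ⟨σ.symm ⟨x, by omega⟩, by simp⟩
  · intro σ _ τ _ h
    have := List.ofFn_injective h
    ext i
    exact congrFun this i
  · intro l hl
    rw [Finset.mem_filter] at hl
    obtain ⟨h1, h2⟩ := hl
    have hlen := length_LX h1
    have h1' := h1
    rw [mem_LX] at h1
    obtain ⟨⟨a1, a2⟩, a3⟩ := h1
    let f : Fin n → Fin n := fun i => ⟨l[i], by
      have := (a2 l[i]).1 (List.getElem_mem _)
      omega⟩
    have hf : Function.Injective f := by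
      intro i j h
      have : l[i] = l[j] := congrArg Fin.val h
      exact Fin.ext ((List.Nodup.getElem_inj_iff a1).1 this)
    let σ : Equiv.Perm (Fin n) := Equiv.ofBijective f (Finite.injective_iff_bijective.1 hf)
    have e : (List.ofFn fun i => (σ i : ℕ)) = l := by
      apply List.ext_getElem
      · simp [hlen]
      · intro i h1 h2
        simp [σ, f]
    refine ⟨σ, ?_, e⟩
    simp only [Av132, Finset.mem_filter, Finset.mem_univ, true_and]
    rw [← LAv_ofFn, ← L111_ofFn, e]
    exact ⟨a3, h2⟩

/-- for `n ≥ 2`, the number of 132-avoiding permutations `σ` of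
`{1,…,n}` with `mmp^{(0,1,1,1)}(σ) = 0` equals `(n-1)·2^{n-2} + 1`. -/
theorem stmt12 (n : ℕ) (hn : 2 ≤ n) :
    ((Av132 n).filter (fun σ => mmp 0 1 1 1 σ = 0)).card
      = (n - 1) * 2 ^ (n - 2) + 1 := by
  obtain ⟨m, rfl⟩ : ∃ m, n = m + 1 := ⟨n - 1, by omega⟩
  rw [card_eq_cnt, cnt_L111]
  rfl
end

section
/- For all ℓ ≥ 1 and all n ≥ ℓ + 4, the highest power of x that occurs in the polynomial Q_{n,132}^{(0,1,ℓ,2)}(x) is x^{n-3-ℓ}, and its coefficient equals 2·C_ℓ; that is, the coefficient of x^{n-3-ℓ} in Q_{n,132}^{(0,1,ℓ,2)}(x) is 2·C_ℓ and the coefficient of x^r is 0 for every r > n-3-ℓ. -/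
open Finset Polynomial

/-- 132-avoidance for words. -/
def AvL (w : List ℕ) : Prop :=
  ∀ (i j k : ℕ) (hij : i < j) (hjk : j < k) (hk : k < w.length),
    ¬ (w[i] < w[k] ∧ w[k] < w[j])

/-- The 132-avoiding word on `[a, a + numNodes)` coded by a binary tree. -/
def treeWord : ℕ → BinaryTree Unit → List ℕ
  | _, .nil => []
  | a, .node _ L R =>
    treeWord (a + R.numNodes) L ++ (a + L.numNodes + R.numNodes) :: treeWord a R

theorem treeWord_length (a : ℕ) (t : BinaryTree Unit) :
    (treeWord a t).length = t.numNodes := by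
  induction t generalizing a with
  | nil => simp [treeWord]
  | node v L R ihL ihR => simp [treeWord, ihL, ihR]; omega

theorem mem_treeWord (a : ℕ) (t : BinaryTree Unit) (x : ℕ) :
    x ∈ treeWord a t ↔ a ≤ x ∧ x < a + t.numNodes := by
  induction t generalizing a with
  | nil => simp [treeWord]
  | node v L R ihL ihR => simp [treeWord, ihL, ihR]; omega

theorem treeWord_nodup (a : ℕ) (t : BinaryTree Unit) : (treeWord a t).Nodup := by
  induction t generalizing a with
  | nil => simp [treeWord]
  | node v L R ihL ihR =>
    simp only [treeWord, List.nodup_append, List.nodup_cons, ihL, ihR, mem_treeWord,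
      List.mem_cons]
    refine ⟨trivial, ⟨by omega, trivial⟩, ?_⟩
    intro x hx y hy
    omega

theorem AvL_join (A B : List ℕ) (M : ℕ) (hA : AvL A) (hB : AvL B)
    (hAM : ∀ x ∈ A, x < M) (hBM : ∀ x ∈ B, x < M) (hAB : ∀ x ∈ A, ∀ y ∈ B, y < x) :
    AvL (A ++ M :: B) := by
  intro i j k hij hjk hk h
  have hAM' : ∀ i (h : i < A.length), A[i] < M := fun i h => hAM _ (List.getElem_mem h)
  have hBM' : ∀ i (h : i < B.length), B[i] < M := fun i h => hBM _ (List.getElem_mem h)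
  have hAB' : ∀ i (h : i < A.length) j (h' : j < B.length), B[j] < A[i] :=
    fun i h j h' => hAB _ (List.getElem_mem h) _ (List.getElem_mem h')
  simp only [List.length_append, List.length_cons] at hk
  simp only [List.getElem_append, List.getElem_cons] at h
  by_cases h1 : k < A.length
  · have := hA i j k hij hjk h1
    grind
  · by_cases h2 : A.length < i
    · have := hB (i - A.length - 1) (j - A.length - 1) (k - A.length - 1) (by omega) (by omega)
        (by omega)
      grind
    · grind

theorem AvL_split (A B : List ℕ) (M : ℕ) (h : AvL (A ++ M :: B))
    (hBM : ∀ x ∈ B, x < M) :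
    AvL A ∧ AvL B ∧ ∀ x ∈ A, ∀ y ∈ B, y ≤ x := by
  refine ⟨?_, ?_, ?_⟩
  · intro i j k hij hjk hk
    have := h i j k hij hjk (by simp; omega)
    grind
  · intro i j k hij hjk hk
    have := h (A.length + 1 + i) (A.length + 1 + j) (A.length + 1 + k) (by omega) (by omega)
      (by simp; omega)
    grind
  · intro x hx y hy
    obtain ⟨i, hi, rfl⟩ := List.getElem_of_mem hx
    have hM := hBM y hy
    obtain ⟨j, hj, rfl⟩ := List.getElem_of_mem hy
    have := h i A.length (A.length + 1 + j) hi (by omega) (by simp; omega)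
    grind

theorem treeWord_av (a : ℕ) (t : BinaryTree Unit) : AvL (treeWord a t) := by
  induction t generalizing a with
  | nil => intro i j k _ _ hk; simp [treeWord] at hk
  | node v L R ihL ihR =>
    rw [treeWord]
    apply AvL_join _ _ _ (ihL _) (ihR _)
    · intro x hx; rw [mem_treeWord] at hx; omega
    · intro x hx; rw [mem_treeWord] at hx; omega
    · intro x hx y hy; rw [mem_treeWord] at hx hy; omega

theorem treeWord_inj (a : ℕ) (t t' : BinaryTree Unit) (h : treeWord a t = treeWord a t') :
    t = t' := by
  induction t generalizing a t' with
  | nil =>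
    cases t' with
    | nil => rfl
    | node v L R => simp [treeWord] at h
  | node v L R ihL ihR =>
    cases t' with
    | nil => simp [treeWord] at h
    | node v' L' R' =>
      have hlen := congrArg List.length h
      simp only [treeWord_length, BinaryTree.numNodes] at hlen
      simp only [treeWord] at h
      rw [List.append_cons_inj_of_notMem (by rw [mem_treeWord]; omega)
        (by rw [mem_treeWord]; omega)] at h
      obtain ⟨h1, h2, h3⟩ := h
      have hR := congrArg List.length h3
      simp only [treeWord_length] at hR
      rw [hR] at h1
      rw [ihL _ _ h1, ihR _ _ h3]

theorem treeWord_surj (n : ℕ) : ∀ (a : ℕ) (w : List ℕ), w.Nodup →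
    (∀ x, x ∈ w ↔ a ≤ x ∧ x < a + n) → AvL w →
    ∃ t : BinaryTree Unit, t.numNodes = n ∧ treeWord a t = w := by
  induction n using Nat.strong_induction_on with
  | _ n ih =>
    intro a w hnd hmem hav
    rcases Nat.eq_zero_or_pos n with rfl | hn
    · refine ⟨.nil, rfl, ?_⟩
      symm
      rw [treeWord, List.eq_nil_iff_forall_not_mem]
      intro x hx
      have := (hmem x).1 hx
      omega
    · have hM : a + n - 1 ∈ w := (hmem _).2 (by omega)
      have hlen : w.length = n := by
        have h1 : w.toFinset = Finset.Ico a (a + n) := by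
          ext x; simp [hmem]
        have h2 := List.toFinset_card_of_nodup hnd
        rw [h1] at h2
        simp at h2
        omega
      obtain ⟨A, B, rfl⟩ := List.append_of_mem hM
      have hnd' := hnd
      simp only [List.nodup_append, List.nodup_cons, List.mem_cons] at hnd
      obtain ⟨hA, ⟨hMB, hB⟩, hdis⟩ := hnd
      simp only [List.length_append, List.length_cons] at hlen
      have hBM : ∀ x ∈ B, x < a + n - 1 := by
        intro x hx
        have h1 := (hmem x).1 (by simp [hx])
        have h2 : x ≠ a + n - 1 := by rintro rfl; exact hMB hx
        omega
      have hAM : ∀ x ∈ A, x < a + n - 1 := by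
        intro x hx
        have h1 := (hmem x).1 (by simp [hx])
        have h2 := hdis x hx (a + n - 1) (Or.inl rfl)
        omega
      obtain ⟨avA, avB, hAB⟩ := AvL_split A B _ hav hBM
      have hBsub : B.toFinset ⊆ Finset.Ico a (a + B.length) := by
        intro x hx
        rw [List.mem_toFinset] at hx
        have h1 := (hmem x).1 (by simp [hx])
        have h2 : Finset.Ico a (x + 1) ⊆ B.toFinset := by
          intro y hy
          rw [Finset.mem_Ico] at hy
          have hy2 := (hmem y).2 (by omega)
          have hxM := hBM x hx
          rw [List.mem_toFinset]
          simp only [List.mem_append, List.mem_cons] at hy2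
          rcases hy2 with hy2 | hy2 | hy2
          · have := hAB y hy2 x hx
            have := hdis y hy2 x (Or.inr hx)
            omega
          · omega
          · exact hy2
        have h3 := Finset.card_le_card h2
        rw [List.toFinset_card_of_nodup hB] at h3
        simp at h3
        simp
        omega
      have hBeq : B.toFinset = Finset.Ico a (a + B.length) := by
        apply Finset.eq_of_subset_of_card_le hBsub
        rw [List.toFinset_card_of_nodup hB]
        simp
      have hBmem : ∀ x, x ∈ B ↔ a ≤ x ∧ x < a + B.length := by
        intro x
        rw [← List.mem_toFinset, hBeq, Finset.mem_Ico]
      have hAmem : ∀ x, x ∈ A ↔ a + B.length ≤ x ∧ x < a + B.length + A.length := by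
        intro x
        constructor
        · intro hx
          have h1 := (hmem x).1 (by simp [hx])
          have h2 := hAM x hx
          have h3 : ¬ x ∈ B := fun hb => hdis x hx x (Or.inr hb) rfl
          rw [hBmem] at h3
          omega
        · intro hx
          have h1 := (hmem x).2 (by omega)
          simp only [List.mem_append, List.mem_cons, hBmem] at h1
          rcases h1 with h1 | h1 | h1
          · exact h1
          · omega
          · omega
      obtain ⟨R, hR, hR'⟩ := ih B.length (by omega) a B hB hBmem avB
      obtain ⟨L, hL, hL'⟩ := ih A.length (by omega) _ A hA hAmem avA
      refine ⟨.node () L R, by simp; omega, ?_⟩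
      rw [treeWord, hR', hR, hL', hL]
      congr 2
      omega

/-- Values of a permutation as a function on `ℕ`. -/
def sv {n : ℕ} (σ : Equiv.Perm (Fin n)) (i : ℕ) : ℕ :=
  if h : i < n then (σ ⟨i, h⟩ : ℕ) else 0

theorem sv_fin {n : ℕ} (σ : Equiv.Perm (Fin n)) (i : Fin n) : sv σ i = (σ i : ℕ) := by
  simp [sv]

theorem sv_lt {n : ℕ} (σ : Equiv.Perm (Fin n)) (i : ℕ) (h : i < n) : sv σ i < n := by
  simp [sv, h]

theorem sv_inj {n : ℕ} (σ : Equiv.Perm (Fin n)) (i j : ℕ) (hi : i < n) (hj : j < n)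
    (h : sv σ i = sv σ j) : i = j := by
  simp only [sv, hi, hj, dif_pos] at h
  have := σ.injective (Fin.ext h)
  simpa using this

theorem sv_surj {n : ℕ} (σ : Equiv.Perm (Fin n)) (x : ℕ) (hx : x < n) :
    ∃ i, i < n ∧ sv σ i = x := by
  refine ⟨σ.symm ⟨x, hx⟩, (σ.symm ⟨x, hx⟩).2, ?_⟩
  rw [sv_fin]; simp

theorem avoids_iff {n : ℕ} (σ : Equiv.Perm (Fin n)) :
    Avoids132 σ ↔ ∀ i j k : ℕ, i < j → j < k → k < n → ¬ (sv σ i < sv σ k ∧ sv σ k < sv σ j) := by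
  unfold Avoids132
  constructor
  · intro h i j k hij hjk hk hh
    apply h
    have hi : i < n := by omega
    have hj : j < n := by omega
    refine ⟨⟨i, hi⟩, ⟨j, hj⟩, ⟨k, hk⟩, hij, hjk, ?_, ?_⟩
    · rw [Fin.lt_def]; simpa [sv, hi, hj, hk] using hh.1
    · rw [Fin.lt_def]; simpa [sv, hi, hj, hk] using hh.2
  · rintro h ⟨i, j, k, hij, hjk, h1, h2⟩
    apply h i j k hij hjk k.2
    simp only [sv_fin]
    exact ⟨h1, h2⟩

/-- The shape of the extremal permutations. -/
def Shape (n l : ℕ) (s : ℕ → ℕ) : Prop :=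
  s 0 = n - 1 ∧ (∀ i, 1 ≤ i → i ≤ l → 2 ≤ s i ∧ s i < l + 2) ∧
  (∀ i, l + 1 ≤ i → i + 3 ≤ n → s i = i + 1) ∧ s (n - 2) ≤ 1 ∧ s (n - 1) ≤ 1

theorem shape_of (n l : ℕ) (hl : 1 ≤ l) (hn : l + 4 ≤ n) (s : ℕ → ℕ)
    (slt : ∀ i, i < n → s i < n)
    (sinj : ∀ i j, i < n → j < n → s i = s j → i = j)
    (ssurj : ∀ x, x < n → ∃ i, i < n ∧ s i = x)
    (sav : ∀ i j k : ℕ, i < j → j < k → k < n → ¬ (s i < s k ∧ s k < s j))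
    (m1 : ∀ i, l + 1 ≤ i → i + 3 ≤ n → ∃ j, j < i ∧ s i < s j)
    (m2 : ∀ i, l + 1 ≤ i → i + 3 ≤ n → ∃ j, j < i ∧ s j < s i)
    (m3 : ∀ a b, a < b → b ≤ l → ¬ (s (l + 1) < s a ∧ s (l + 1) < s b))
    (m4 : s (n - 2) < s (n - 3)) (m5 : s (n - 1) < s (n - 3)) : Shape n l s := by
  have h0 : s 0 = n - 1 := by
    obtain ⟨p, hp, hps⟩ := ssurj (n - 1) (by omega)
    by_cases hp0 : p = 0
    · rw [← hp0]; exact hps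
    exfalso
    have hs3 := slt (n - 3) (by omega)
    by_cases hpl : p ≤ l
    · have h1 := sav 0 p (l + 1) (by omega) (by omega) (by omega)
      have h2 := m3 0 p (by omega) hpl
      have h3 := slt (l + 1) (by omega)
      have h4 := sinj (l + 1) p (by omega) hp
      have h5 := sinj (l + 1) 0 (by omega) (by omega)
      omega
    · by_cases hp3 : p + 3 ≤ n
      · obtain ⟨j, hj, hj'⟩ := m1 p (by omega) hp3
        have := slt j (by omega)
        omega
      · have : p = n - 2 ∨ p = n - 1 := by omega
        rcases this with rfl | rfl <;> omega
  have hbase : ∀ j, 1 ≤ j → j < l + 1 → s j < s (l + 1) := by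
    intro j hj hj'
    have h1 := m3 0 j (by omega) (by omega)
    have h3 := slt (l + 1) (by omega)
    have h4 := sinj (l + 1) j (by omega) (by omega)
    have h5 := sinj (l + 1) 0 (by omega) (by omega)
    omega
  have hinc : ∀ i, l + 1 ≤ i → i + 3 ≤ n → ∀ j, 1 ≤ j → j < i → s j < s i := by
    intro i hi
    induction i, hi using Nat.le_induction with
    | base => intro _; exact hbase
    | succ i hi ih =>
      intro hin j hj hji
      have key : s i < s (i + 1) := by
        obtain ⟨j0, hj0, hj0'⟩ := m2 (i + 1) (by omega) hin
        by_cases h : j0 = i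
        · rw [← h]; rw [h] at hj0' ⊢; exact hj0'
        · have h1 := sav j0 i (i + 1) (by omega) (by omega) (by omega)
          have h2 := sinj i (i + 1) (by omega) (by omega)
          omega
      by_cases h : j = i
      · rw [h]; exact key
      · have := ih (by omega) j hj (by omega)
        omega
  have hlow : ∀ j, j + 3 ≤ n → s (n - 2) < s j ∧ s (n - 1) < s j := by
    intro j hj
    have b1 := slt (n - 2) (by omega)
    have b2 := slt (n - 1) (by omega)
    have i1 := sinj (n - 2) j (by omega) (by omega)
    have i2 := sinj (n - 1) j (by omega) (by omega)
    by_cases hj3 : j = n - 3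
    · subst hj3; exact ⟨m4, m5⟩
    · have h1 := sav j (n - 3) (n - 2) (by omega) (by omega) (by omega)
      have h2 := sav j (n - 3) (n - 1) (by omega) (by omega) (by omega)
      omega
  have hdiff := sinj (n - 2) (n - 1) (by omega) (by omega)
  have hlast : s (n - 2) ≤ 1 ∧ s (n - 1) ≤ 1 := by
    obtain ⟨p, hp, hps⟩ := ssurj 0 (by omega)
    obtain ⟨q, hq, hqs⟩ := ssurj 1 (by omega)
    have hpn : p = n - 2 ∨ p = n - 1 := by
      by_contra hh
      have := hlow p (by omega)
      omega
    have hqn : q = n - 2 ∨ q = n - 1 := by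
      by_contra hh
      have := hlow q (by omega)
      omega
    rcases hpn with rfl | rfl <;> rcases hqn with rfl | rfl <;> omega
  have hmid : ∀ d i, i + 3 + d = n → l + 1 ≤ i → s i = i + 1 := by
    intro d
    induction d using Nat.strong_induction_on with
    | _ d ih =>
      intro i hid hi
      have key : ∀ q, i < q → q + 3 ≤ n → s q = q + 1 := by
        intro q hq hqn
        exact ih (n - 3 - q) (by omega) q (by omega) (by omega)
      obtain ⟨q, hq, hqs⟩ := ssurj (i + 1) (by omega)
      have hq0 : q ≠ 0 := by rintro rfl; omega
      have hq2 : q ≠ n - 2 := by rintro rfl; omega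
      have hq1 : q ≠ n - 1 := by rintro rfl; omega
      rcases Nat.lt_trichotomy q i with h | h | h
      · have h1 := hinc i hi (by omega) q (by omega) h
        have h2 := slt i (by omega)
        have h3 := sinj i 0 (by omega) (by omega)
        have h4 := key (s i - 1) (by omega) (by omega)
        have h5 := sinj i (s i - 1) (by omega) (by omega)
        omega
      · rw [← h]; omega
      · have := key q h (by omega)
        omega
  refine ⟨h0, ?_, ?_, hlast⟩
  · intro i hi hil
    have h1 := hbase i hi (by omega)
    have h2 := hmid (n - 3 - (l + 1)) (l + 1) (by omega) (by omega)
    have h3 := hlow i (by omega)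
    omega
  · intro i hi hin
    exact hmid (n - 3 - i) i (by omega) hi

theorem matches_range {n l : ℕ} (σ : Equiv.Perm (Fin n)) (i : Fin n)
    (h : MatchesMMP 0 1 l 2 σ i) : l + 1 ≤ (i : ℕ) ∧ (i : ℕ) + 3 ≤ n := by
  obtain ⟨-, hb, hc, hd⟩ := h
  constructor
  · have hdis : Disjoint (Finset.univ.filter (fun j => j < i ∧ σ i < σ j))
        (Finset.univ.filter (fun j => j < i ∧ σ j < σ i)) := by
      rw [Finset.disjoint_filter]
      rintro j - ⟨-, h1⟩ ⟨-, h2⟩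
      exact absurd h1 (not_lt.2 h2.le)
    have hsub : (Finset.univ.filter (fun j => j < i ∧ σ i < σ j)) ∪
        (Finset.univ.filter (fun j => j < i ∧ σ j < σ i)) ⊆ Finset.Iio i := by
      intro j hj
      simp at hj ⊢
      tauto
    have := Finset.card_le_card hsub
    rw [Finset.card_union_of_disjoint hdis, Fin.card_Iio] at this
    omega
  · have hsub : (Finset.univ.filter (fun j => i < j ∧ σ j < σ i)) ⊆ Finset.Ioi i := by
      intro j hj
      simp at hj ⊢
      tauto
    have := Finset.card_le_card hsub
    rw [Fin.card_Ioi] at this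
    omega

theorem filter_sub {n l : ℕ} (hn : l + 4 ≤ n) (σ : Equiv.Perm (Fin n)) :
    Finset.univ.filter (MatchesMMP 0 1 l 2 σ) ⊆
      Finset.Ico (⟨l + 1, by omega⟩ : Fin n) ⟨n - 2, by omega⟩ := by
  intro i hi
  rw [Finset.mem_filter] at hi
  have := matches_range σ i hi.2
  rw [Finset.mem_Ico, Fin.le_def, Fin.lt_def]
  simp only
  omega

theorem mmp_le {n l : ℕ} (hn : l + 4 ≤ n) (σ : Equiv.Perm (Fin n)) :
    mmp 0 1 l 2 σ ≤ n - 3 - l := by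
  have := Finset.card_le_card (filter_sub hn σ)
  rw [Fin.card_Ico] at this
  unfold mmp
  simp only at this
  omega

theorem mmp_eq_iff {n l : ℕ} (hn : l + 4 ≤ n) (σ : Equiv.Perm (Fin n)) :
    mmp 0 1 l 2 σ = n - 3 - l ↔
      ∀ i : Fin n, l + 1 ≤ (i : ℕ) → (i : ℕ) + 3 ≤ n → MatchesMMP 0 1 l 2 σ i := by
  have hcard : (Finset.Ico (⟨l + 1, by omega⟩ : Fin n) ⟨n - 2, by omega⟩).card = n - 3 - l := by
    rw [Fin.card_Ico]; simp only; omega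
  constructor
  · intro h i h1 h2
    have := Finset.eq_of_subset_of_card_le (filter_sub hn σ) (by rw [hcard, ← h]; rfl)
    have hi : i ∈ Finset.Ico (⟨l + 1, by omega⟩ : Fin n) ⟨n - 2, by omega⟩ := by
      rw [Finset.mem_Ico, Fin.le_def, Fin.lt_def]
      simp only
      omega
    rw [← this, Finset.mem_filter] at hi
    exact hi.2
  · intro h
    have : Finset.univ.filter (MatchesMMP 0 1 l 2 σ) =
        Finset.Ico (⟨l + 1, by omega⟩ : Fin n) ⟨n - 2, by omega⟩ := by
      apply Finset.Subset.antisymm (filter_sub hn σ)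
      intro i hi
      rw [Finset.mem_Ico, Fin.le_def, Fin.lt_def] at hi
      simp only at hi
      rw [Finset.mem_filter]
      exact ⟨Finset.mem_univ _, h i (by omega) (by omega)⟩
    unfold mmp
    rw [this, hcard]

theorem shape_of_matches {n l : ℕ} (hl : 1 ≤ l) (hn : l + 4 ≤ n) (σ : Equiv.Perm (Fin n))
    (hav : Avoids132 σ)
    (h : ∀ i : Fin n, l + 1 ≤ (i : ℕ) → (i : ℕ) + 3 ≤ n → MatchesMMP 0 1 l 2 σ i) :
    Shape n l (sv σ) := by
  have m45 : sv σ (n - 2) < sv σ (n - 3) ∧ sv σ (n - 1) < sv σ (n - 3) := by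
    obtain ⟨-, -, -, hd⟩ := h ⟨n - 3, by omega⟩ (by simp only; omega) (by simp only; omega)
    have e1 := sv_fin σ ⟨n - 1, by omega⟩
    have e2 := sv_fin σ ⟨n - 2, by omega⟩
    have e3 := sv_fin σ ⟨n - 3, by omega⟩
    simp only at e1 e2 e3
    have hsub : (Finset.univ.filter
        (fun j => (⟨n - 3, by omega⟩ : Fin n) < j ∧ σ j < σ ⟨n - 3, by omega⟩)) ⊆
        {(⟨n - 2, by omega⟩ : Fin n), ⟨n - 1, by omega⟩} := by
      intro j hj
      simp only [Finset.mem_filter, Finset.mem_univ, true_and, Fin.lt_def] at hj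
      simp only [Finset.mem_insert, Finset.mem_singleton, Fin.ext_iff]
      omega
    have heq := Finset.eq_of_subset_of_card_le hsub (le_trans Finset.card_le_two hd)
    have a1 : (⟨n - 2, by omega⟩ : Fin n) ∈ (Finset.univ.filter
        (fun j => (⟨n - 3, by omega⟩ : Fin n) < j ∧ σ j < σ ⟨n - 3, by omega⟩)) := by
      rw [heq]; simp
    have a2 : (⟨n - 1, by omega⟩ : Fin n) ∈ (Finset.univ.filter
        (fun j => (⟨n - 3, by omega⟩ : Fin n) < j ∧ σ j < σ ⟨n - 3, by omega⟩)) := by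
      rw [heq]; simp
    rw [Finset.mem_filter] at a1 a2
    rw [e1, e2, e3]
    exact ⟨a1.2.2, a2.2.2⟩
  apply shape_of n l hl hn (sv σ) (sv_lt σ) (sv_inj σ) (sv_surj σ) ((avoids_iff σ).1 hav)
    ?_ ?_ ?_ m45.1 m45.2
  · intro i hi hin
    obtain ⟨-, hb, -, -⟩ := h ⟨i, by omega⟩ hi hin
    obtain ⟨j, hj⟩ := Finset.card_pos.1 (lt_of_lt_of_le Nat.zero_lt_one hb)
    rw [Finset.mem_filter] at hj
    refine ⟨j, hj.2.1, ?_⟩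
    have := sv_fin σ ⟨i, by omega⟩
    simp only at this
    rw [this, sv_fin]
    exact hj.2.2
  · intro i hi hin
    obtain ⟨-, -, hc, -⟩ := h ⟨i, by omega⟩ hi hin
    obtain ⟨j, hj⟩ := Finset.card_pos.1 (lt_of_lt_of_le hl hc)
    rw [Finset.mem_filter] at hj
    refine ⟨j, hj.2.1, ?_⟩
    have := sv_fin σ ⟨i, by omega⟩
    simp only at this
    rw [this, sv_fin]
    exact hj.2.2
  · rintro a b hab hbl ⟨h1, h2⟩
    obtain ⟨-, -, hc, -⟩ := h ⟨l + 1, by omega⟩ le_rfl (by simp only; omega)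
    have e1 := sv_fin σ ⟨l + 1, by omega⟩
    have e2 := sv_fin σ ⟨a, by omega⟩
    have e3 := sv_fin σ ⟨b, by omega⟩
    simp only at e1 e2 e3
    rw [e1, e2] at h1
    rw [e1, e3] at h2
    have hsub : (Finset.univ.filter
        (fun j => j < (⟨l + 1, by omega⟩ : Fin n) ∧ σ j < σ ⟨l + 1, by omega⟩)) ⊆
        ((Finset.Iio (⟨l + 1, by omega⟩ : Fin n)).erase ⟨a, by omega⟩).erase ⟨b, by omega⟩ := by
      intro j hj
      simp only [Finset.mem_filter, Finset.mem_univ, true_and] at hj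
      simp only [Finset.mem_erase, Finset.mem_Iio]
      refine ⟨?_, ?_, hj.1⟩
      · rintro rfl
        exact absurd (Fin.lt_def.1 hj.2) (by omega)
      · rintro rfl
        exact absurd (Fin.lt_def.1 hj.2) (by omega)
    have := Finset.card_le_card hsub
    rw [Finset.card_erase_of_mem, Finset.card_erase_of_mem, Fin.card_Iio] at this
    · simp only at this
      omega
    · rw [Finset.mem_Iio, Fin.lt_def]; simp only; omega
    · rw [Finset.mem_erase, Finset.mem_Iio, Fin.lt_def, Ne, Fin.ext_iff]; simp only; omega

theorem matches_of_shape {n l : ℕ} (hn : l + 4 ≤ n) (σ : Equiv.Perm (Fin n))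
    (h : Shape n l (sv σ)) (i : Fin n) (hi : l + 1 ≤ (i : ℕ)) (hin : (i : ℕ) + 3 ≤ n) :
    MatchesMMP 0 1 l 2 σ i := by
  obtain ⟨h0, h1, h2, h3, h4⟩ := h
  have hsi := h2 i hi hin
  have ltiff : ∀ a b : Fin n, σ a < σ b ↔ sv σ a < sv σ b := by
    intro a b; rw [sv_fin, sv_fin, Fin.lt_def]
  refine ⟨Nat.zero_le _, ?_, ?_, ?_⟩
  · apply Finset.card_pos.2
    refine ⟨⟨0, by omega⟩, ?_⟩
    rw [Finset.mem_filter, ltiff, Fin.lt_def]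
    simp only [Finset.mem_univ, true_and]
    omega
  · have hsub : Finset.Ico (⟨1, by omega⟩ : Fin n) ⟨l + 1, by omega⟩ ⊆
        Finset.univ.filter (fun j => j < i ∧ σ j < σ i) := by
      intro j hj
      rw [Finset.mem_Ico, Fin.le_def, Fin.lt_def] at hj
      simp only at hj
      rw [Finset.mem_filter, ltiff, Fin.lt_def]
      have := h1 j (by omega) (by omega)
      simp only [Finset.mem_univ, true_and]
      omega
    have := Finset.card_le_card hsub
    rw [Fin.card_Ico] at this
    simpa using this
  · have hsub : Finset.Ici (⟨n - 2, by omega⟩ : Fin n) ⊆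
        Finset.univ.filter (fun j => i < j ∧ σ j < σ i) := by
      intro j hj
      rw [Finset.mem_Ici, Fin.le_def] at hj
      simp only at hj
      have hjn := j.2
      rw [Finset.mem_filter, ltiff, Fin.lt_def]
      have : (j : ℕ) = n - 2 ∨ (j : ℕ) = n - 1 := by omega
      have : sv σ j ≤ 1 := by rcases this with h | h <;> rw [h] <;> assumption
      simp only [Finset.mem_univ, true_and]
      omega
    have := Finset.card_le_card hsub
    rw [Fin.card_Ici] at this
    simp only at this
    omega

/-- The word of a permutation. -/
def wordOf {n : ℕ} (σ : Equiv.Perm (Fin n)) : List ℕ := List.ofFn (fun i => (σ i : ℕ))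

theorem wordOf_length {n : ℕ} (σ : Equiv.Perm (Fin n)) : (wordOf σ).length = n := by
  simp [wordOf]

theorem wordOf_getElem {n : ℕ} (σ : Equiv.Perm (Fin n)) (i : ℕ) (h : i < (wordOf σ).length) :
    (wordOf σ)[i] = sv σ i := by
  have : i < n := by simpa [wordOf] using h
  simp [wordOf, sv, this]

theorem wordOf_inj {n : ℕ} : Function.Injective (wordOf (n := n)) := by
  intro σ τ h
  have := List.ofFn_injective h
  ext i
  exact congrFun this i

theorem exists_perm (n : ℕ) (W : List ℕ) (hlen : W.length = n) (hnd : W.Nodup)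
    (hlt : ∀ x ∈ W, x < n) : ∃ σ : Equiv.Perm (Fin n), wordOf σ = W := by
  subst hlen
  let f : Fin W.length → Fin W.length := fun i => ⟨W[i], hlt _ (List.getElem_mem _)⟩
  have hf : Function.Injective f := by
    intro i j h
    simp only [f, Fin.mk.injEq] at h
    exact Fin.ext ((hnd.getElem_inj_iff).1 h)
  refine ⟨Equiv.ofBijective f (Finite.injective_iff_bijective.1 hf), ?_⟩
  apply List.ext_getElem
  · simp [wordOf]
  · intro i h1 h2
    simp [wordOf, f]

/-- The word of the extremal permutation coded by a tree and a boolean. -/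
def extWord (n l : ℕ) (p : BinaryTree Unit × Bool) : List ℕ :=
  (n - 1) :: (treeWord 2 p.1 ++ (List.range' (l + 2) (n - 3 - l) ++
    if p.2 then [0, 1] else [1, 0]))

theorem extWord_inj (n l : ℕ) :
    Set.InjOn (extWord n l)
      ((BinaryTree.treesOfNumNodesEq l ×ˢ (Finset.univ : Finset Bool) :
        Finset (BinaryTree Unit × Bool)) : Set (BinaryTree Unit × Bool)) := by
  rintro ⟨t, b⟩ h ⟨t', b'⟩ h' heq
  simp only [Finset.coe_product, Set.mem_prod, Finset.mem_coe,
    BinaryTree.mem_treesOfNumNodesEq] at h h'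
  simp only [extWord, List.cons.injEq, true_and] at heq
  have := List.append_inj heq (by rw [treeWord_length, treeWord_length, h.1, h'.1])
  have h1 := treeWord_inj _ _ _ this.1
  have h2 := List.append_cancel_left this.2
  subst h1
  cases b <;> cases b' <;> simp at h2 ⊢

theorem wordOf_of_shape {n l : ℕ} (hn : l + 4 ≤ n) (σ : Equiv.Perm (Fin n))
    (hav : Avoids132 σ) (h : Shape n l (sv σ)) :
    ∃ p ∈ BinaryTree.treesOfNumNodesEq l ×ˢ (Finset.univ : Finset Bool),
      extWord n l p = wordOf σ := by
  obtain ⟨h0, h1, h2, h3, h4⟩ := h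
  rw [avoids_iff] at hav
  obtain ⟨t, ht, ht'⟩ := treeWord_surj l 2 ((List.range l).map (fun i => sv σ (i + 1)))
    (by
      apply List.Nodup.map_on _ List.nodup_range
      intro x hx y hy hxy
      rw [List.mem_range] at hx hy
      have := sv_inj σ _ _ (by omega) (by omega) hxy
      omega)
    (by
      intro x
      rw [List.mem_map]
      constructor
      · rintro ⟨i, hi, rfl⟩
        rw [List.mem_range] at hi
        have := h1 (i + 1) (by omega) (by omega)
        omega
      · intro hx
        obtain ⟨i, hi, rfl⟩ := sv_surj σ x (by omega)
        have i0 : i ≠ 0 := by rintro rfl; omega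
        have i1 : i ≠ n - 2 := by rintro rfl; omega
        have i2 : i ≠ n - 1 := by rintro rfl; omega
        have i3 : i ≤ l := by
          by_contra hh
          have := h2 i (by omega) (by omega)
          omega
        exact ⟨i - 1, by rw [List.mem_range]; omega, by rw [Nat.sub_add_cancel (by omega)]⟩)
    (by
      intro i j k hij hjk hk
      have hk' : k < l := by simpa using hk
      simpa using hav (i + 1) (j + 1) (k + 1) (by omega) (by omega) (by omega))
  refine ⟨(t, decide (sv σ (n - 2) = 0)), ?_, ?_⟩
  · rw [Finset.mem_product, BinaryTree.mem_treesOfNumNodesEq]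
    exact ⟨ht, Finset.mem_univ _⟩
  · have hne : sv σ (n - 2) ≠ sv σ (n - 1) := by
      intro h
      have := sv_inj σ _ _ (by omega) (by omega) h
      omega
    have hif : (if decide (sv σ (n - 2) = 0) = true then [0, 1] else [1, 0]) =
        [sv σ (n - 2), sv σ (n - 1)] := by
      by_cases h : sv σ (n - 2) = 0
      · have : sv σ (n - 1) = 1 := by omega
        simp [h, this]
      · have h5 : sv σ (n - 1) = 0 := by omega
        have h6 : sv σ (n - 2) = 1 := by omega
        simp [h5, h6]
    unfold extWord
    rw [hif, ht']
    apply List.ext_getElem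
    · simp [wordOf_length]; omega
    · intro i hi hi'
      rw [wordOf_getElem]
      rw [wordOf_length] at hi'
      by_cases c0 : i = 0
      · subst c0; simp [h0]
      · obtain ⟨j, rfl⟩ : ∃ j, i = j + 1 := ⟨i - 1, by omega⟩
        rw [List.getElem_cons_succ]
        by_cases c1 : j < l
        · rw [List.getElem_append_left (by simpa using c1)]
          simp
        · rw [List.getElem_append_right (by simpa using c1)]
          simp only [List.length_map, List.length_range]
          by_cases c2 : j - l < n - 3 - l
          · rw [List.getElem_append_left (by simpa using c2), h2 _ (by omega) (by omega)]
            simp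
            omega
          · rw [List.getElem_append_right (by simpa using c2)]
            simp only [List.length_range']
            have : j + 1 = n - 2 ∨ j + 1 = n - 1 := by omega
            rcases this with h | h
            · have e : j - l - (n - 3 - l) = 0 := by omega
              simp [e, h]
            · have e : j - l - (n - 3 - l) = 1 := by omega
              simp [e, h]

theorem shape_of_word {n l : ℕ} (hn : l + 4 ≤ n) (p : BinaryTree Unit × Bool)
    (hp : p.1.numNodes = l) :
    ∃ σ : Equiv.Perm (Fin n), wordOf σ = extWord n l p ∧ Avoids132 σ ∧ Shape n l (sv σ) := by
  obtain ⟨t, b⟩ := p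
  simp only at hp
  have hlen : (treeWord 2 t).length = l := by rw [treeWord_length, hp]
  obtain ⟨x, y, hxy, hif⟩ : ∃ x y : ℕ, x + y = 1 ∧ (if b then [0, 1] else [1, 0]) = [x, y] := by
    cases b
    · exact ⟨1, 0, rfl, rfl⟩
    · exact ⟨0, 1, rfl, rfl⟩
  have hmem := mem_treeWord 2 t
  rw [hp] at hmem
  obtain ⟨σ, hσ⟩ := exists_perm n (extWord n l (t, b))
    (by simp only [extWord, hif]; simp [hlen]; omega)
    (by
      simp only [extWord, hif]
      simp only [List.nodup_cons, List.nodup_append, treeWord_nodup,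
        List.mem_append, hmem, List.mem_range'_1, List.mem_cons, List.not_mem_nil, or_false,
        List.nodup_nil, and_true, true_and, not_false_eq_true]
      refine ⟨by omega, ⟨List.nodup_range', by omega, ?_⟩, ?_⟩
      · intro a ha c hc; omega
      · intro a ha c hc; omega)
    (by
      intro z hz
      simp only [extWord, hif] at hz
      simp only [List.mem_cons, List.mem_append, hmem, List.mem_range'_1, List.not_mem_nil,
        or_false] at hz
      omega)
  have hget : ∀ i (h : i < n), sv σ i = (extWord n l (t, b))[i]'(by
      rw [← hσ, wordOf_length]; exact h) := by
    intro i h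
    rw [← wordOf_getElem σ i (by rw [wordOf_length]; exact h)]
    simp only [hσ]
  have g0 : sv σ 0 = n - 1 := by rw [hget 0 (by omega)]; simp [extWord]
  have g1 : ∀ i (hi : i < l), sv σ (i + 1) = (treeWord 2 t)[i]'(by omega) := by
    intro i hi
    rw [hget (i + 1) (by omega)]
    simp only [extWord, List.getElem_cons_succ]
    rw [List.getElem_append_left (by omega)]
  have g2 : ∀ i, l + 1 ≤ i → i + 3 ≤ n → sv σ i = i + 1 := by
    intro i hi hin
    obtain ⟨j, rfl⟩ : ∃ j, i = j + 1 := ⟨i - 1, by omega⟩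
    rw [hget (j + 1) (by omega)]
    simp only [extWord, List.getElem_cons_succ]
    rw [List.getElem_append_right (by omega), List.getElem_append_left (by simp; omega)]
    simp
    omega
  have g3 : ∀ i, n ≤ i + 2 → i < n → sv σ i ≤ 1 := by
    intro i hi hin
    obtain ⟨j, rfl⟩ : ∃ j, i = j + 1 := ⟨i - 1, by omega⟩
    rw [hget (j + 1) (by omega)]
    simp only [extWord, List.getElem_cons_succ, hif]
    rw [List.getElem_append_right (by omega), List.getElem_append_right (by simp; omega)]
    have : ∀ k (h : k < [x, y].length), [x, y][k] ≤ 1 := by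
      intro k h
      have := List.getElem_mem h
      simp only [List.mem_cons, List.not_mem_nil, or_false] at this
      omega
    apply this
  have g1' : ∀ i, 1 ≤ i → i ≤ l → 2 ≤ sv σ i ∧ sv σ i < l + 2 := by
    intro i hi hil
    obtain ⟨j, rfl⟩ : ∃ j, i = j + 1 := ⟨i - 1, by omega⟩
    rw [g1 j (by omega)]
    have := (hmem _).1 (List.getElem_mem (l := treeWord 2 t) (n := j) (by omega))
    omega
  refine ⟨σ, hσ, ?_, g0, g1', g2, g3 _ (by omega) (by omega), g3 _ (by omega) (by omega)⟩
  rw [avoids_iff]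
  rintro i j k hij hjk hk ⟨a1, a2⟩
  have bj := sv_lt σ j (by omega)
  have hi0 : i ≠ 0 := by rintro rfl; have := sv_lt σ k hk; omega
  by_cases c1 : k ≤ l
  · obtain ⟨i, rfl⟩ : ∃ j, i = j + 1 := ⟨i - 1, by omega⟩
    obtain ⟨j, rfl⟩ : ∃ i, j = i + 1 := ⟨j - 1, by omega⟩
    obtain ⟨k, rfl⟩ : ∃ i, k = i + 1 := ⟨k - 1, by omega⟩
    rw [g1 _ (by omega), g1 _ (by omega)] at a1 a2
    exact treeWord_av 2 t i j k (by omega) (by omega) (by omega) ⟨a1, a2⟩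
  · by_cases c2 : k + 3 ≤ n
    · have hk' := g2 k (by omega) c2
      by_cases c3 : j ≤ l
      · have := g1' j (by omega) c3
        omega
      · have := g2 j (by omega) (by omega)
        omega
    · have hk' := g3 k (by omega) hk
      by_cases c3 : i ≤ l
      · have := g1' i (by omega) c3
        omega
      · have := g2 i (by omega) (by omega)
        omega

theorem card_ext (l n : ℕ) (hl : 1 ≤ l) (hn : l + 4 ≤ n) :
    ((Av132 n).filter (fun σ => n - 3 - l = mmp 0 1 l 2 σ)).card = 2 * catalan l := by
  have himg : ((Av132 n).filter (fun σ => n - 3 - l = mmp 0 1 l 2 σ)).image wordOf =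
      (BinaryTree.treesOfNumNodesEq l ×ˢ (Finset.univ : Finset Bool)).image (extWord n l) := by
    ext w
    simp only [Finset.mem_image]
    constructor
    · rintro ⟨σ, hσ, rfl⟩
      rw [Finset.mem_filter, Av132, Finset.mem_filter, eq_comm, mmp_eq_iff hn] at hσ
      obtain ⟨⟨-, hav⟩, hm⟩ := hσ
      exact wordOf_of_shape hn σ hav (shape_of_matches hl hn σ hav hm)
    · rintro ⟨p, hp, rfl⟩
      rw [Finset.mem_product, BinaryTree.mem_treesOfNumNodesEq] at hp
      obtain ⟨σ, h1, h2, h3⟩ := shape_of_word hn p hp.1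
      refine ⟨σ, ?_, h1⟩
      rw [Finset.mem_filter, Av132, Finset.mem_filter, eq_comm, mmp_eq_iff hn]
      exact ⟨⟨Finset.mem_univ _, h2⟩, matches_of_shape hn σ h3⟩
  have hc := congrArg Finset.card himg
  rw [Finset.card_image_of_injective _ wordOf_inj, Finset.card_image_of_injOn (extWord_inj n l),
    Finset.card_product, BinaryTree.treesOfNumNodesEq_card_eq_catalan] at hc
  rw [hc]
  simp [mul_comm]

/-- for `ℓ ≥ 1` and `n ≥ ℓ + 4`, the highest power of `x` in
`Q_{n,132}^{(0,1,ℓ,2)}(x)` is `x^{n-3-ℓ}`, with coefficient `2·C_ℓ`. -/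
theorem stmt13 (l n : ℕ) (hl : 1 ≤ l) (hn : l + 4 ≤ n) :
    (Q n 0 1 l 2).coeff (n - 3 - l) = (2 * catalan l : ℤ) ∧
    ∀ r : ℕ, n - 3 - l < r → (Q n 0 1 l 2).coeff r = 0 := by
  have hQ : ∀ r : ℕ, (Q n 0 1 l 2).coeff r =
      (((Av132 n).filter (fun σ => r = mmp 0 1 l 2 σ)).card : ℤ) := by
    intro r
    rw [Q, Polynomial.finsetSum_coeff]
    simp only [Polynomial.coeff_X_pow]
    rw [Finset.sum_boole]
  constructor
  · rw [hQ, card_ext l n hl hn]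
    push_cast
    rfl
  · intro r hr
    rw [hQ, Finset.filter_false_of_mem]
    · simp
    · intro σ _ h
      have := mmp_le hn σ
      omega
end

section
/- For all ℓ, k, m ≥ 1 and all n ≥ k + m, the polynomials Q_{n,132}^{(ℓ,k,0,m)}(x) satisfy the recurrence Q_{n,132}^{(ℓ,k,0,m)}(x) = Σ_{i=1}^{k-1} C_{i-1} · Q_{n-i,132}^{(ℓ,k-i,0,m)}(x) + Σ_{i=k}^{n-m} Q_{i-1,132}^{(ℓ-1,k,0,0)}(x) · Q_{n-i,132}^{(ℓ,0,0,m)}(x) + Σ_{i=n-m+1}^{n} Q_{i-1,132}^{(ℓ-1,k,0,m-(n-i))}(x) · C_{n-i}. -/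
open Finset Polynomial

def iL {a : ℕ} (b : ℕ) (p : Fin a) : Fin (a + 1 + b) := Fin.castAdd b (Fin.castSucc p)
def iM (a b : ℕ) : Fin (a + 1 + b) := Fin.castAdd b (Fin.last a)
def iR (a : ℕ) {b : ℕ} (q : Fin b) : Fin (a + 1 + b) := Fin.natAdd (a + 1) q

@[simp] lemma iL_val {a : ℕ} (b : ℕ) (p : Fin a) : (iL b p).val = p.val := rfl
@[simp] lemma iM_val (a b : ℕ) : (iM a b).val = a := rfl
@[simp] lemma iR_val (a : ℕ) {b : ℕ} (q : Fin b) : (iR a q).val = a + 1 + q.val := rfl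

lemma cases3 {a b : ℕ} (x : Fin (a + 1 + b)) :
    (∃ p, x = iL b p) ∨ x = iM a b ∨ ∃ q, x = iR a q := by
  refine Fin.addCases (fun y => ?_) (fun q => Or.inr (Or.inr ⟨q, rfl⟩)) x
  exact Fin.lastCases (Or.inr (Or.inl rfl)) (fun p => Or.inl ⟨p, rfl⟩) y

lemma card3 {a b : ℕ} (P : Fin (a + 1 + b) → Prop) [DecidablePred P] :
    (univ.filter P).card = (univ.filter (fun p => P (iL b p))).card
      + (if P (iM a b) then 1 else 0) + (univ.filter (fun q => P (iR a q))).card := by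
  simp only [Finset.card_filter]
  rw [Fin.sum_univ_add, Fin.sum_univ_castSucc]
  rfl

def glueVal {a b : ℕ} (A : Equiv.Perm (Fin a)) (B : Equiv.Perm (Fin b))
    (x : Fin (a + 1 + b)) : Fin (a + 1 + b) :=
  if h : x.val < a then ⟨b + A ⟨x.val, h⟩, by have := (A ⟨x.val, h⟩).2; omega⟩
  else if h2 : x.val = a then ⟨a + b, by omega⟩
  else ⟨B ⟨x.val - (a + 1), by have := x.2; omega⟩,
    by have := (B ⟨x.val - (a + 1), by have := x.2; omega⟩).2; omega⟩

section
variable {a b : ℕ} (A : Equiv.Perm (Fin a)) (B : Equiv.Perm (Fin b))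

lemma glueVal_L (p : Fin a) : (glueVal A B (iL b p)).val = b + (A p).val := by
  simp [glueVal]
lemma glueVal_M : (glueVal A B (iM a b)).val = a + b := by
  simp [glueVal]
lemma glueVal_R (q : Fin b) : (glueVal A B (iR a q)).val = (B q).val := by
  have h : ¬ (a + 1 + q.val < a) := by omega
  have h2 : ¬ (a + 1 + q.val = a) := by omega
  simp [glueVal, h, h2]

lemma glueVal_inj : Function.Injective (glueVal A B) := by
  intro x y h
  replace h := congrArg Fin.val h
  revert h
  rcases cases3 x with ⟨p, rfl⟩ | rfl | ⟨q, rfl⟩ <;>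
  rcases cases3 y with ⟨p', rfl⟩ | rfl | ⟨q', rfl⟩ <;>
  simp only [glueVal_L, glueVal_M, glueVal_R] <;> intro h
  · have : A p = A p' := Fin.ext (by omega)
    rw [A.injective this]
  · have := (A p).2; omega
  · have := (B q').2; omega
  · have := (A p').2; omega
  · trivial
  · have := (B q').2; omega
  · have := (B q).2; omega
  · have := (B q).2; omega
  · have : B q = B q' := Fin.ext (by omega)
    rw [B.injective this]

noncomputable def glue : Equiv.Perm (Fin (a + 1 + b)) :=
  Equiv.ofBijective (glueVal A B) (Finite.injective_iff_bijective.1 (glueVal_inj A B))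

@[simp] lemma glue_L (p : Fin a) : (glue A B (iL b p)).val = b + (A p).val := glueVal_L A B p
@[simp] lemma glue_M : (glue A B (iM a b)).val = a + b := glueVal_M A B
@[simp] lemma glue_R (q : Fin b) : (glue A B (iR a q)).val = (B q).val := glueVal_R A B q

lemma glue_avoids : Avoids132 (glue A B) ↔ Avoids132 A ∧ Avoids132 B := by
  unfold Avoids132
  constructor
  · intro h
    constructor
    · rintro ⟨i, j, k, h1, h2, h3, h4⟩
      apply h
      refine ⟨iL b i, iL b j, iL b k, ?_⟩
      simp only [Fin.lt_def, iL_val, glue_L] at *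
      omega
    · rintro ⟨i, j, k, h1, h2, h3, h4⟩
      apply h
      refine ⟨iR a i, iR a j, iR a k, ?_⟩
      simp only [Fin.lt_def, iR_val, glue_R] at *
      omega
  · rintro ⟨hA, hB⟩ ⟨i, j, k, h⟩
    revert h
    rcases cases3 i with ⟨p, rfl⟩ | rfl | ⟨q, rfl⟩ <;>
    rcases cases3 j with ⟨p', rfl⟩ | rfl | ⟨q', rfl⟩ <;>
    rcases cases3 k with ⟨p'', rfl⟩ | rfl | ⟨q'', rfl⟩ <;>
    simp only [Fin.lt_def, iL_val, iM_val, iR_val, glue_L, glue_M, glue_R] <;>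
    rintro ⟨h1, h2, h3, h4⟩
    · exact hA ⟨p, p', p'', by simp only [Fin.lt_def]; omega⟩
    all_goals first
      | omega
      | exact hB ⟨q, q', q'', by simp only [Fin.lt_def]; omega⟩
      | (have := (B q'').2; omega)
      | (have := (A p).2; have := (B q'').2; omega)

lemma matches_L (l k m : ℕ) (hl : 1 ≤ l) (p : Fin a) :
    MatchesMMP l k 0 m (glue A B) (iL b p) ↔ MatchesMMP (l - 1) k 0 (m - b) A p := by
  have hA := (A p).2
  have e1 : ∀ q : Fin b, ¬ (b + (A p).val < (B q).val) := fun q => by have := (B q).2; omega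
  have e2 : ∀ q : Fin b, ((B q).val < b + (A p).val) := fun q => by have := (B q).2; omega
  have e3 : ∀ q : Fin b, p.val < a + 1 + q.val := fun q => by have := p.2; omega
  have e5 : b + (A p).val < a + b := by omega
  have e6 : ¬ (a < p.val) := by have := p.2; omega
  have e7 : ∀ q : Fin b, ¬ (a + 1 + q.val < p.val) := fun q => by have := p.2; omega
  have e8 : ¬ (a + b < b + (A p).val) := by omega
  unfold MatchesMMP
  simp only [card3, Fin.lt_def, iL_val, iM_val, iR_val, glue_L, glue_M, glue_R, e1, e2, e3,
    e5, e6, e7, e8, p.2, add_lt_add_iff_left, and_true, and_false, false_and, true_and,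
    if_true, if_false, Finset.filter_false, Finset.filter_true, Finset.card_empty,
    Finset.card_univ, Fintype.card_fin]
  omega

lemma matches_M (l k m : ℕ) (hl : 1 ≤ l) :
    ¬ MatchesMMP l k 0 m (glue A B) (iM a b) := by
  rintro ⟨h, -⟩
  have : (univ.filter (fun j => iM a b < j ∧ glue A B (iM a b) < glue A B j)) = ∅ := by
    rw [Finset.filter_eq_empty_iff]
    intro x _ hx
    have := (glue A B x).2
    simp only [Fin.lt_def, glue_M] at hx
    omega
  rw [this] at h
  simp at h
  omega

lemma matches_R (l k m : ℕ) (q : Fin b) :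
    MatchesMMP l k 0 m (glue A B) (iR a q) ↔ MatchesMMP l (k - (a + 1)) 0 m B q := by
  have hB := (B q).2
  have e1 : ∀ p : Fin a, ¬ (b + (A p).val < (B q).val) := fun p => by omega
  have e2 : ∀ p : Fin a, ((B q).val < b + (A p).val) := fun p => by omega
  have e3 : ∀ p : Fin a, p.val < a + 1 + q.val := fun p => by have := p.2; omega
  have e4 : ∀ p : Fin a, ¬ (a + 1 + q.val < p.val) := fun p => by have := p.2; omega
  have e5 : (B q).val < a + b := by omega
  have e6 : ¬ (a + 1 + q.val < a) := by omega
  have e7 : a < a + 1 + q.val := by omega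
  have e8 : ¬ (a + b < (B q).val) := by omega
  unfold MatchesMMP
  simp only [card3, Fin.lt_def, iL_val, iM_val, iR_val, glue_L, glue_M, glue_R, e1, e2, e3, e4,
    e5, e6, e7, e8, add_lt_add_iff_left, and_true, and_false, false_and, true_and,
    if_true, if_false, Finset.filter_false, Finset.filter_true, Finset.card_empty,
    Finset.card_univ, Fintype.card_fin]
  omega

lemma mmp_glue (l k m : ℕ) (hl : 1 ≤ l) :
    mmp l k 0 m (glue A B) = mmp (l - 1) k 0 (m - b) A + mmp l (k - (a + 1)) 0 m B := by
  unfold mmp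
  rw [card3]
  simp only [matches_L A B l k m hl, matches_M A B l k m hl, matches_R, if_false, add_zero]

end

lemma glue_surj {a b : ℕ} (σ : Equiv.Perm (Fin (a + 1 + b))) (hσ : Avoids132 σ)
    (hM : (σ (iM a b)).val = a + b) :
    ∃ (A : Equiv.Perm (Fin a)) (B : Equiv.Perm (Fin b)), glue A B = σ := by
  have hlt : ∀ x, x ≠ iM a b → (σ x).val < a + b := by
    intro x hx
    have h1 := (σ x).2
    have h2 : (σ x).val ≠ a + b := by
      intro h
      exact hx (σ.injective (Fin.ext (h.trans hM.symm)))
    omega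
  have hLM : ∀ p : Fin a, iL b p ≠ iM a b := fun p h => by
    have := congrArg Fin.val h
    have := p.2
    simp at *
    omega
  have hRM : ∀ q : Fin b, iR a q ≠ iM a b := fun q h => by
    have := congrArg Fin.val h
    simp at *
    omega
  have hLR : ∀ (p : Fin a) (q : Fin b), (σ (iR a q)).val < (σ (iL b p)).val := by
    intro p q
    by_contra hcon
    have hne : (σ (iL b p)).val ≠ (σ (iR a q)).val := by
      intro h
      have := congrArg Fin.val (σ.injective (Fin.ext h))
      have := p.2
      simp at *
      omega
    have h3 := hlt _ (hRM q)
    have := p.2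
    apply hσ
    refine ⟨iL b p, iM a b, iR a q, ?_⟩
    simp only [Fin.lt_def, iL_val, iM_val, iR_val, hM]
    omega
  have hL : ∀ p : Fin a, b ≤ (σ (iL b p)).val := by
    intro p
    have h := Finset.card_le_card_of_injOn (s := (univ : Finset (Fin b)))
      (t := Finset.range (σ (iL b p)).val) (fun q => (σ (iR a q)).val)
      (by intro q _; simpa using hLR p q)
      (by
        intro q _ q' _ h
        have := congrArg Fin.val (σ.injective (Fin.ext h))
        apply Fin.ext
        simp at this
        omega)
    simpa using h
  have hR : ∀ q : Fin b, (σ (iR a q)).val < b := by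
    intro q
    have h := Finset.card_le_card_of_injOn (s := (univ : Finset (Fin a)))
      (t := Finset.Ioo (σ (iR a q)).val (a + b)) (fun p => (σ (iL b p)).val)
      (by intro p _; simpa using ⟨hLR p q, hlt _ (hLM p)⟩)
      (by
        intro q _ q' _ h
        have := congrArg Fin.val (σ.injective (Fin.ext h))
        apply Fin.ext
        simpa using this)
    have := hlt _ (hRM q)
    simp at h
    omega
  let fA : Fin a → Fin a := fun p => ⟨(σ (iL b p)).val - b, by
    have := hL p
    have := hlt _ (hLM p)
    omega⟩
  let fB : Fin b → Fin b := fun q => ⟨(σ (iR a q)).val, hR q⟩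
  have iA : Function.Injective fA := by
    intro p p' h
    have h' := congrArg Fin.val h
    simp only [fA] at h'
    have := hL p
    have := hL p'
    have := congrArg Fin.val (σ.injective (Fin.ext (by omega : (σ (iL b p)).val = (σ (iL b p')).val)))
    exact Fin.ext (by simpa using this)
  have iB : Function.Injective fB := by
    intro p p' h
    have h' := congrArg Fin.val h
    simp only [fB] at h'
    have := congrArg Fin.val (σ.injective (Fin.ext h'))
    exact Fin.ext (by simpa using this)
  refine ⟨Equiv.ofBijective fA (Finite.injective_iff_bijective.1 iA),
    Equiv.ofBijective fB (Finite.injective_iff_bijective.1 iB), ?_⟩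
  apply Equiv.ext
  intro x
  apply Fin.ext
  rcases cases3 x with ⟨p, rfl⟩ | rfl | ⟨q, rfl⟩
  · rw [glue_L]
    have := hL p
    simp [fA]
    omega
  · rw [glue_M, hM]
  · rw [glue_R]
    simp [fB]

lemma glue_injective {a b : ℕ} {A A' : Equiv.Perm (Fin a)} {B B' : Equiv.Perm (Fin b)}
    (h : glue A B = glue A' B') : A = A' ∧ B = B' := by
  constructor
  · apply Equiv.ext
    intro p
    have := congrArg (fun s => (s (iL b p)).val) h
    simp at this
    exact Fin.ext this
  · apply Equiv.ext
    intro q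
    have := congrArg (fun s => (s (iR a q)).val) h
    simp at this
    exact Fin.ext this

lemma fiber (l k m a b n : ℕ) (hl : 1 ≤ l) (h : n = a + 1 + b) :
    ∑ σ ∈ (Av132 n).filter (fun σ => (σ ⟨a, by omega⟩).val + 1 = n),
      (Polynomial.X : Polynomial ℤ) ^ (mmp l k 0 m σ)
    = Q a (l - 1) k 0 (m - b) * Q b l (k - (a + 1)) 0 m := by
  subst h
  unfold Q
  rw [Finset.sum_mul_sum, ← Finset.sum_product']
  symm
  refine Finset.sum_bij (fun x _ => glue x.1 x.2) ?_ ?_ ?_ ?_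
  · rintro ⟨A, B⟩ hx
    simp only [Av132, Finset.mem_product, Finset.mem_filter, Finset.mem_univ, true_and] at hx ⊢
    refine ⟨(glue_avoids A B).2 hx, ?_⟩
    have := glue_M A B
    change (glue A B (iM a b)).val + 1 = _
    omega
  · rintro ⟨A, B⟩ _ ⟨A', B'⟩ _ h
    obtain ⟨h1, h2⟩ := glue_injective h
    exact Prod.ext h1 h2
  · intro σ hσ
    simp only [Av132, Finset.mem_filter, Finset.mem_univ, true_and] at hσ
    obtain ⟨h1, h2⟩ := hσ
    change (σ (iM a b)).val + 1 = _ at h2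
    obtain ⟨A, B, rfl⟩ := glue_surj σ h1 (by omega)
    refine ⟨(A, B), ?_, rfl⟩
    simpa [Av132] using (glue_avoids A B).1 h1
  · rintro ⟨A, B⟩ _
    rw [mmp_glue A B l k m hl, pow_add]

lemma Q_rec (l k m n : ℕ) (hl : 1 ≤ l) (hn : 1 ≤ n) :
    Q n l k 0 m = ∑ i ∈ Finset.range n,
      Q i (l - 1) k 0 (m - (n - 1 - i)) * Q (n - 1 - i) l (k - (i + 1)) 0 m := by
  rw [← Fin.sum_univ_eq_sum_range (fun i =>
      Q i (l - 1) k 0 (m - (n - 1 - i)) * Q (n - 1 - i) l (k - (i + 1)) 0 m)]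
  rw [Q, ← Finset.sum_fiberwise (Av132 n) (fun σ => σ.symm ⟨n - 1, by omega⟩)]
  refine Finset.sum_congr rfl fun i _ => ?_
  rw [← fiber l k m i (n - 1 - i) n hl (by omega)]
  refine Finset.sum_congr (Finset.filter_congr fun σ _ => ?_) fun _ _ => rfl
  rw [Equiv.symm_apply_eq, Fin.ext_iff]
  change n - 1 = (σ i).val ↔ (σ i).val + 1 = n
  omega

lemma eval_Q (n a b c d : ℕ) : (Q n a b c d).eval 1 = ((Av132 n).card : ℤ) := by
  simp [Q, Polynomial.eval_finsetSum]

lemma card_Av (n : ℕ) : (Av132 n).card = catalan n := by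
  induction n using Nat.strong_induction_on with
  | _ n ih =>
    rcases n with _ | n
    · rw [catalan_zero]; decide
    · have h := congrArg (Polynomial.eval 1) (Q_rec 1 0 0 (n + 1) le_rfl (by omega))
      rw [Polynomial.eval_finsetSum] at h
      simp only [Polynomial.eval_mul, eval_Q] at h
      rw [catalan_succ, Fin.sum_univ_eq_sum_range (fun i => catalan i * catalan (n - i))]
      have h2 : (Av132 (n + 1)).card = ∑ i ∈ Finset.range (n + 1),
          (Av132 i).card * (Av132 (n + 1 - 1 - i)).card := by exact_mod_cast h
      rw [h2]
      refine Finset.sum_congr rfl fun i hi => ?_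
      rw [Finset.mem_range] at hi
      rw [ih i hi, ih _ (by omega)]
      simp

lemma Q_eq_catalan (n a b c d : ℕ)
    (h : ∀ (σ : Equiv.Perm (Fin n)) (i : Fin n), ¬ MatchesMMP a b c d σ i) :
    Q n a b c d = (catalan n : Polynomial ℤ) := by
  have : ∀ σ : Equiv.Perm (Fin n), mmp a b c d σ = 0 := by
    intro σ
    simp [mmp, h]
  simp [Q, this, card_Av]

lemma count_lt {n : ℕ} (i : Fin n) (P : Fin n → Prop) [DecidablePred P] (h : ¬ P i) :
    (univ.filter P).card < n := by
  have : (univ.filter P).card < (univ : Finset (Fin n)).card := by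
    apply Finset.card_lt_card
    rw [Finset.filter_ssubset]
    exact ⟨i, Finset.mem_univ _, h⟩
  simpa using this

lemma Q_small_b (n a b c d : ℕ) (h : n ≤ b) : Q n a b c d = (catalan n : Polynomial ℤ) := by
  apply Q_eq_catalan
  rintro σ i ⟨-, h2, -⟩
  have := count_lt i (fun j => j < i ∧ σ i < σ j) (by simp)
  omega

lemma Q_small_d (n a b c d : ℕ) (h : n ≤ d) : Q n a b c d = (catalan n : Polynomial ℤ) := by
  apply Q_eq_catalan
  rintro σ i ⟨-, -, -, h2⟩
  have := count_lt i (fun j => i < j ∧ σ j < σ i) (by simp)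
  omega

/-- the recurrence for `Q_{n,132}^{(ℓ,k,0,m)}(x)` for `ℓ,k,m ≥ 1`, `n ≥ k+m`. -/
theorem stmt15 (l k m n : ℕ) (hl : 1 ≤ l) (hk : 1 ≤ k) (hm : 1 ≤ m) (hn : k + m ≤ n) :
    Q n l k 0 m =
      (∑ i ∈ Finset.Icc 1 (k - 1),
        (catalan (i - 1) : Polynomial ℤ) * Q (n - i) l (k - i) 0 m) +
      (∑ i ∈ Finset.Icc k (n - m), Q (i - 1) (l - 1) k 0 0 * Q (n - i) l 0 0 m) +
      ∑ i ∈ Finset.Icc (n - m + 1) n,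
        Q (i - 1) (l - 1) k 0 (m - (n - i)) * (catalan (n - i) : Polynomial ℤ) := by
  have hR : Q n l k 0 m = ∑ i ∈ Finset.Ico 1 (n + 1),
      Q (i - 1) (l - 1) k 0 (m - (n - i)) * Q (n - i) l (k - i) 0 m := by
    rw [Q_rec l k m n hl (by omega), Finset.sum_Ico_eq_sum_range]
    refine Finset.sum_congr (by simp) fun i _ => ?_
    rw [show 1 + i - 1 = i by omega, show n - (1 + i) = n - 1 - i by omega,
      show 1 + i = i + 1 by omega]
  rw [hR, ← Finset.sum_Ico_consecutive _ (show 1 ≤ n - m + 1 by omega)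
      (show n - m + 1 ≤ n + 1 by omega),
    ← Finset.sum_Ico_consecutive _ hk (show k ≤ n - m + 1 by omega)]
  congr 1
  · congr 1
    · refine Finset.sum_congr (by ext; simp; omega) fun i hi => ?_
      rw [Finset.mem_Icc] at hi
      rw [Q_small_b (i - 1) _ _ _ _ (by omega)]
    · refine Finset.sum_congr (by ext; simp) fun i hi => ?_
      rw [Finset.mem_Icc] at hi
      rw [show m - (n - i) = 0 by omega, show k - i = 0 by omega]
  · refine Finset.sum_congr (by ext; simp) fun i hi => ?_
    rw [Finset.mem_Icc] at hi
    rw [Q_small_d (n - i) _ _ _ _ (by omega)]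
end

section
/- For all n ≥ 5, the coefficient of x^{n-4} in the polynomial Q_{n,132}^{(1,1,0,1)}(x) equals 8·C_{n-3} + C_{n-4}. -/
open Finset Polynomial

namespace MMPAux

/-- position embedding of the left block -/
def pL (a b : ℕ) (i : Fin a) : Fin (a + b + 1) := ⟨i, by omega⟩
/-- position of the maximum -/
def pM (a b : ℕ) : Fin (a + b + 1) := ⟨a, by omega⟩
/-- position embedding of the right block -/
def pR (a b : ℕ) (j : Fin b) : Fin (a + b + 1) := ⟨a + 1 + j, by omega⟩

theorem cases_pos {a b : ℕ} (k : Fin (a + b + 1)) :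
    (∃ i, k = pL a b i) ∨ k = pM a b ∨ ∃ j, k = pR a b j := by
  rcases lt_trichotomy k.val a with h | h | h
  · exact Or.inl ⟨⟨k, h⟩, Fin.ext rfl⟩
  · exact Or.inr (Or.inl (Fin.ext h))
  · refine Or.inr (Or.inr ⟨⟨k - a - 1, by omega⟩, Fin.ext ?_⟩)
    simp only [pR]; omega

theorem exists_pos {a b : ℕ} (P : Fin (a + b + 1) → Prop) :
    (∃ k, P k) ↔ (∃ i, P (pL a b i)) ∨ P (pM a b) ∨ ∃ j, P (pR a b j) := by
  constructor
  · rintro ⟨k, hk⟩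
    rcases cases_pos k with ⟨i, rfl⟩ | rfl | ⟨i, rfl⟩
    · exact Or.inl ⟨_, hk⟩
    · exact Or.inr (Or.inl hk)
    · exact Or.inr (Or.inr ⟨_, hk⟩)
  · rintro (⟨i, h⟩ | h | ⟨i, h⟩)
    exacts [⟨_, h⟩, ⟨_, h⟩, ⟨_, h⟩]

theorem sum_pos {a b : ℕ} (f : Fin (a + b + 1) → ℕ) :
    ∑ k, f k = ∑ i, f (pL a b i) + f (pM a b) + ∑ j, f (pR a b j) := by
  have h : a + 1 + b = a + b + 1 := by omega
  rw [← Equiv.sum_comp (finCongr h) f, Fin.sum_univ_add, Fin.sum_univ_castSucc]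
  rfl

/-- underlying function of `join` -/
def joinFun {a b : ℕ} (A : Equiv.Perm (Fin a)) (B : Equiv.Perm (Fin b)) (k : Fin (a + b + 1)) :
    Fin (a + b + 1) :=
  if h : k.val < a then ⟨b + A ⟨k, h⟩, by omega⟩
  else if h2 : k.val = a then ⟨a + b, by omega⟩
  else ⟨B ⟨k - a - 1, by omega⟩, by omega⟩

theorem joinFun_L {a b : ℕ} (A : Equiv.Perm (Fin a)) (B : Equiv.Perm (Fin b)) (i : Fin a) :
    (joinFun A B (pL a b i)).val = b + A i := by
  simp [joinFun, pL]

theorem joinFun_M {a b : ℕ} (A : Equiv.Perm (Fin a)) (B : Equiv.Perm (Fin b)) :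
    (joinFun A B (pM a b)).val = a + b := by
  simp [joinFun, pM]

theorem joinFun_R {a b : ℕ} (A : Equiv.Perm (Fin a)) (B : Equiv.Perm (Fin b)) (j : Fin b) :
    (joinFun A B (pR a b j)).val = B j := by
  have h1 : ¬ (a + 1 + j.val < a) := by omega
  have h2 : ¬ (a + 1 + j.val = a) := by omega
  have h3 : a + 1 + j.val - a - 1 = j := by omega
  simp [joinFun, pR, h1, h2, h3]

theorem joinFun_inj {a b : ℕ} (A : Equiv.Perm (Fin a)) (B : Equiv.Perm (Fin b)) :
    Function.Injective (joinFun A B) := by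
  intro k l h
  have h' := congrArg Fin.val h
  rcases cases_pos k with ⟨i, rfl⟩ | rfl | ⟨i, rfl⟩ <;>
  rcases cases_pos l with ⟨j, rfl⟩ | rfl | ⟨j, rfl⟩ <;>
  simp only [joinFun_L, joinFun_M, joinFun_R] at h'
  · have : A i = A j := Fin.ext (by omega)
    rw [A.injective this]
  · omega
  · omega
  · omega
  · rfl
  · omega
  · omega
  · omega
  · have : B i = B j := Fin.ext (by omega)
    rw [B.injective this]

/-- `A (max) B` with the values of `A` above those of `B`. -/
noncomputable def join {a b : ℕ} (A : Equiv.Perm (Fin a)) (B : Equiv.Perm (Fin b)) :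
    Equiv.Perm (Fin (a + b + 1)) :=
  Equiv.ofBijective (joinFun A B) (Finite.injective_iff_bijective.1 (joinFun_inj A B))

section
variable {a b : ℕ} (A : Equiv.Perm (Fin a)) (B : Equiv.Perm (Fin b))

theorem join_L (i : Fin a) : (join A B (pL a b i)).val = b + A i := joinFun_L A B i
theorem join_M : (join A B (pM a b)).val = a + b := joinFun_M A B
theorem join_R (j : Fin b) : (join A B (pR a b j)).val = B j := joinFun_R A B j
theorem pL_val (i : Fin a) : (pL a b i).val = i := rfl
theorem pM_val : (pM a b).val = a := rfl
theorem pR_val (j : Fin b) : (pR a b j).val = a + 1 + j := rfl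

theorem join_avoids (hA : Avoids132 A) (hB : Avoids132 B) : Avoids132 (join A B) := by
  rintro ⟨i, j, k, h1, h2, h3, h4⟩
  rcases cases_pos i with ⟨i, rfl⟩ | rfl | ⟨i, rfl⟩ <;>
  rcases cases_pos j with ⟨j, rfl⟩ | rfl | ⟨j, rfl⟩ <;>
  rcases cases_pos k with ⟨k, rfl⟩ | rfl | ⟨k, rfl⟩ <;>
  simp only [Fin.lt_def, join_L, join_M, join_R, pL_val, pM_val, pR_val] at h1 h2 h3 h4 <;>
  first
  | omega
  | exact hA ⟨i, j, k, by omega, by omega, by omega, by omega⟩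
  | exact hB ⟨i, j, k, by omega, by omega, by omega, by omega⟩

theorem avoids_of_join (h : Avoids132 (join A B)) : Avoids132 A ∧ Avoids132 B := by
  constructor
  · rintro ⟨i, j, k, h1, h2, h3, h4⟩
    refine h ⟨pL a b i, pL a b j, pL a b k, ?_⟩
    simp only [Fin.lt_def, join_L, pL_val] at *
    omega
  · rintro ⟨i, j, k, h1, h2, h3, h4⟩
    refine h ⟨pR a b i, pR a b j, pR a b k, ?_⟩
    simp only [Fin.lt_def, join_R, pR_val] at *
    omega

end

/-- upper right point exists -/
def UR {n : ℕ} (σ : Equiv.Perm (Fin n)) (i : Fin n) : Prop := ∃ j, i < j ∧ σ i < σ j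
/-- upper left point exists -/
def UL {n : ℕ} (σ : Equiv.Perm (Fin n)) (i : Fin n) : Prop := ∃ j, j < i ∧ σ i < σ j
/-- lower right point exists -/
def LR {n : ℕ} (σ : Equiv.Perm (Fin n)) (i : Fin n) : Prop := ∃ j, i < j ∧ σ j < σ i

section
variable {a b : ℕ} (A : Equiv.Perm (Fin a)) (B : Equiv.Perm (Fin b))

theorem UR_L (i : Fin a) : UR (join A B) (pL a b i) ↔ True := by
  simp only [iff_true]
  refine ⟨pM a b, ?_⟩
  simp only [Fin.lt_def, join_L, join_M, pL_val, pM_val]; omega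
theorem UR_M : UR (join A B) (pM a b) ↔ False := by
  simp only [iff_false]
  rintro ⟨j, h1, h2⟩
  have := (join A B j).2
  simp only [Fin.lt_def, join_M] at h2
  omega
theorem UR_R (i : Fin b) : UR (join A B) (pR a b i) ↔ UR B i := by
  unfold UR
  rw [exists_pos]
  simp only [Fin.lt_def, join_L, join_M, join_R, pL_val, pM_val, pR_val]
  constructor
  · rintro (⟨j, h⟩ | h | ⟨j, h⟩)
    · omega
    · omega
    · exact ⟨j, by omega⟩
  · rintro ⟨j, h⟩
    exact Or.inr (Or.inr ⟨j, by omega⟩)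
theorem UL_L (i : Fin a) : UL (join A B) (pL a b i) ↔ UL A i := by
  unfold UL
  rw [exists_pos]
  simp only [Fin.lt_def, join_L, join_M, join_R, pL_val, pM_val, pR_val]
  constructor
  · rintro (⟨j, h⟩ | h | ⟨j, h⟩)
    · exact ⟨j, by omega⟩
    · omega
    · omega
  · rintro ⟨j, h⟩
    exact Or.inl ⟨j, by omega⟩
theorem UL_M : UL (join A B) (pM a b) ↔ False := by
  simp only [iff_false]
  rintro ⟨j, h1, h2⟩
  have := (join A B j).2
  simp only [Fin.lt_def, join_M] at h2
  omega
theorem UL_R (i : Fin b) : UL (join A B) (pR a b i) ↔ True := by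
  simp only [iff_true]
  refine ⟨pM a b, ?_⟩
  simp only [Fin.lt_def, join_R, join_M, pR_val, pM_val]; omega
theorem LR_L (i : Fin a) : LR (join A B) (pL a b i) ↔ (LR A i ∨ 0 < b) := by
  unfold LR
  rw [exists_pos]
  simp only [Fin.lt_def, join_L, join_M, join_R, pL_val, pM_val, pR_val]
  constructor
  · rintro (⟨j, h⟩ | h | ⟨j, h⟩)
    · exact Or.inl ⟨j, by omega⟩
    · omega
    · right; omega
  · rintro (⟨j, h⟩ | h)
    · exact Or.inl ⟨j, by omega⟩
    · exact Or.inr (Or.inr ⟨⟨0, h⟩, by omega⟩)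
theorem LR_M : LR (join A B) (pM a b) ↔ 0 < b := by
  unfold LR
  rw [exists_pos]
  simp only [Fin.lt_def, join_L, join_M, join_R, pL_val, pM_val, pR_val]
  constructor
  · rintro (⟨j, h⟩ | h | ⟨j, h⟩)
    · omega
    · omega
    · omega
  · intro h
    exact Or.inr (Or.inr ⟨⟨0, h⟩, by omega⟩)
theorem LR_R (i : Fin b) : LR (join A B) (pR a b i) ↔ LR B i := by
  unfold LR
  rw [exists_pos]
  simp only [Fin.lt_def, join_L, join_M, join_R, pL_val, pM_val, pR_val]
  constructor
  · rintro (⟨j, h⟩ | h | ⟨j, h⟩)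
    · omega
    · omega
    · exact ⟨j, by omega⟩
  · rintro ⟨j, h⟩
    exact Or.inr (Or.inr ⟨j, by omega⟩)
end

open Classical in
/-- number of positions failing one of the required conditions -/
noncomputable def dfc (x y z : Prop) {n : ℕ} (σ : Equiv.Perm (Fin n)) : ℕ :=
  ∑ i, if (x → UR σ i) ∧ (y → UL σ i) ∧ (z → LR σ i) then 0 else 1

section
variable {a b : ℕ} (A : Equiv.Perm (Fin a)) (B : Equiv.Perm (Fin b))

theorem dfc_join (x y z : Prop) : dfc x y z (join A B) =
    dfc False y (z ∧ b = 0) A + (open Classical in if x ∨ y ∨ (z ∧ b = 0) then 1 else 0)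
      + dfc x False z B := by
  classical
  unfold dfc
  rw [sum_pos]
  simp only [UR_L, UR_M, UR_R, UL_L, UL_M, UL_R, LR_L, LR_M, LR_R]
  congr 1
  · congr 1
    · apply Finset.sum_congr rfl
      intro i _
      by_cases hb : b = 0
      · simp [hb]
      · simp [hb, Nat.pos_of_ne_zero hb]
    · have : 0 < b ↔ ¬ b = 0 := Nat.pos_iff_ne_zero
      simp only [this]
      by_cases x <;> by_cases y <;> by_cases z <;> by_cases b = 0 <;> simp_all
  · simp

end

theorem dfc_zero (x y z : Prop) (σ : Equiv.Perm (Fin 0)) : dfc x y z σ = 0 := by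
  simp [dfc]

theorem dfc_F {n : ℕ} (σ : Equiv.Perm (Fin n)) : dfc False False False σ = 0 := by
  simp [dfc]

theorem mmp_add_dfc {n : ℕ} (σ : Equiv.Perm (Fin n)) :
    mmp 1 1 0 1 σ + dfc True True True σ = n := by
  classical
  have h : ∀ i, MatchesMMP 1 1 0 1 σ i ↔
      ((True → UR σ i) ∧ (True → UL σ i) ∧ (True → LR σ i)) := by
    intro i
    simp [MatchesMMP, UR, UL, LR, Nat.one_le_iff_ne_zero, Finset.filter_eq_empty_iff]
  have h2 : mmp 1 1 0 1 σ = ∑ i, if MatchesMMP 1 1 0 1 σ i then 1 else 0 := by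
    rw [mmp, Finset.card_filter]
  rw [h2, dfc, ← Finset.sum_add_distrib]
  trans ∑ i : Fin n, 1
  · apply Finset.sum_congr rfl
    intro i _
    simp only [← h]
    split_ifs <;> rfl
  · simp

/-- decomposition of a 132-avoiding permutation -/
theorem exists_join {n : ℕ} (σ : Equiv.Perm (Fin (n + 1))) (hσ : Avoids132 σ) :
    ∃ (a b : ℕ) (A : Equiv.Perm (Fin a)) (B : Equiv.Perm (Fin b)),
      Avoids132 A ∧ Avoids132 B ∧
      (⟨a + b + 1, join A B⟩ : Σ n, Equiv.Perm (Fin n)) = ⟨n + 1, σ⟩ := by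
  obtain ⟨p, hp⟩ : ∃ p, σ p = Fin.last n := σ.surjective _
  obtain ⟨a, b, hab, hpa⟩ : ∃ a b, n = a + b ∧ p.val = a := ⟨p, n - p, by omega, rfl⟩
  subst hab
  have hp' : p = pM a b := Fin.ext hpa
  subst hp'
  have hM : (σ (pM a b)).val = a + b := by rw [hp]; rfl
  have hlt : ∀ k, k ≠ pM a b → (σ k).val < a + b := by
    intro k hk
    have h1 : σ k ≠ σ (pM a b) := fun h => hk (σ.injective h)
    have h2 : (σ k).val ≠ a + b := fun h => h1 (Fin.ext (by omega))
    omega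
  have hLR : ∀ i j, (σ (pR a b j)).val < (σ (pL a b i)).val := by
    intro i j
    by_contra hcon
    have h1 : σ (pR a b j) ≠ σ (pL a b i) := by
      intro h
      have := congrArg Fin.val (σ.injective h)
      simp only [pR_val, pL_val] at this
      omega
    have h1' : (σ (pR a b j)).val ≠ (σ (pL a b i)).val := fun h => h1 (Fin.ext h)
    have h3 := hlt (pR a b j) (by
      intro h
      have := congrArg Fin.val h
      simp only [pR_val, pM_val] at this
      omega)
    refine hσ ⟨pL a b i, pM a b, pR a b j, ?_⟩
    simp only [Fin.lt_def, pR_val, pL_val, pM_val]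
    omega
  have hRinj : ∀ j j', (σ (pR a b j)).val = (σ (pR a b j')).val → j = j' := by
    intro j j' h
    have := congrArg Fin.val (σ.injective (Fin.ext h))
    simp only [pR_val] at this
    exact Fin.ext (by omega)
  have hLinj : ∀ j j', (σ (pL a b j)).val = (σ (pL a b j')).val → j = j' := by
    intro j j' h
    have := congrArg Fin.val (σ.injective (Fin.ext h))
    simp only [pL_val] at this
    exact Fin.ext (by omega)
  have hL : ∀ i, b ≤ (σ (pL a b i)).val := by
    intro i
    have := Finset.card_le_card_of_injOn (s := (Finset.univ : Finset (Fin b)))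
      (t := Finset.range (σ (pL a b i)).val) (fun j => (σ (pR a b j)).val)
      (by intro j _; simpa using hLR i j) (by intro j _ j' _ h; exact hRinj j j' h)
    simpa using this
  have hLu : ∀ i, (σ (pL a b i)).val < a + b := by
    intro i
    apply hlt
    intro h
    have := congrArg Fin.val h
    simp only [pL_val, pM_val] at this
    omega
  have hR : ∀ j, (σ (pR a b j)).val < b := by
    intro j
    have h3 := hlt (pR a b j) (by
      intro h
      have := congrArg Fin.val h
      simp only [pR_val, pM_val] at this
      omega)
    have := Finset.card_le_card_of_injOn (s := (Finset.univ : Finset (Fin a)))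
      (t := Finset.Ico ((σ (pR a b j)).val + 1) (a + b)) (fun i => (σ (pL a b i)).val)
      (by
        intro i _
        have h1 := hLR i j
        have h2 := hLu i
        simp only [Finset.coe_Ico, Set.mem_Ico]
        omega) (by intro j _ j' _ h; exact hLinj j j' h)
    simp at this
    omega
  let fA : Fin a → Fin a := fun i => ⟨(σ (pL a b i)).val - b, by
    have := hL i; have := hLu i; omega⟩
  let fB : Fin b → Fin b := fun j => ⟨(σ (pR a b j)).val, hR j⟩
  have hfA : Function.Injective fA := by
    intro i j h
    have h := congrArg Fin.val h
    simp only [fA] at h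
    have := hL i; have := hL j
    exact hLinj i j (by omega)
  have hfB : Function.Injective fB := by
    intro i j h
    have h2 : (fB i).val = (fB j).val := congrArg Fin.val h
    exact hRinj i j h2
  let A : Equiv.Perm (Fin a) := Equiv.ofBijective fA (Finite.injective_iff_bijective.1 hfA)
  let B : Equiv.Perm (Fin b) := Equiv.ofBijective fB (Finite.injective_iff_bijective.1 hfB)
  have key : join A B = σ := by
    ext k
    rcases cases_pos k with ⟨i, rfl⟩ | rfl | ⟨i, rfl⟩
    · rw [join_L]
      have : (A i).val = (σ (pL a b i)).val - b := rfl
      have := hL i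
      omega
    · rw [join_M, hM]
    · rw [join_R]; rfl
  have hav := avoids_of_join A B (by rw [key]; exact hσ)
  exact ⟨a, b, A, B, hav.1, hav.2, by rw [key]⟩

/-- value function on `ℕ` -/
def pv (s : Σ n, Equiv.Perm (Fin n)) (k : ℕ) : ℕ :=
  if h : k < s.1 then (s.2 ⟨k, h⟩).val else 0

theorem join_sigma_inj {a b a' b' : ℕ} {A : Equiv.Perm (Fin a)} {B : Equiv.Perm (Fin b)}
    {A' : Equiv.Perm (Fin a')} {B' : Equiv.Perm (Fin b')}
    (h : (⟨a + b + 1, join A B⟩ : Σ n, Equiv.Perm (Fin n)) = ⟨a' + b' + 1, join A' B'⟩) :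
    (⟨a, A⟩ : Σ n, Equiv.Perm (Fin n)) = ⟨a', A'⟩ ∧
    (⟨b, B⟩ : Σ n, Equiv.Perm (Fin n)) = ⟨b', B'⟩ := by
  have hn : a + b + 1 = a' + b' + 1 := congrArg Sigma.fst h
  have hM' : pv ⟨a' + b' + 1, join A' B'⟩ a' = a' + b' := by
    have h1 : a' < a' + b' + 1 := by omega
    have h2 := join_M A' B'
    simp only [pv, h1, dif_pos]
    exact h2
  have haa : a = a' := by
    have e : pM a b = (⟨a', by omega⟩ : Fin (a + b + 1)) := by
      apply (join A B).injective
      apply Fin.ext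
      rw [join_M]
      rw [← h] at hM'
      simp only [pv] at hM'
      rw [dif_pos (by omega)] at hM'
      omega
    exact congrArg Fin.val e
  subst haa
  have hbb : b = b' := by omega
  subst hbb
  have h' : join A B = join A' B' := by simpa using h
  constructor
  · congr 1
    ext i
    have := congrArg (fun s => (s (pL a b i)).val) h'
    simp only [join_L] at this
    omega
  · congr 1
    ext i
    have := congrArg (fun s => (s (pR a b i)).val) h'
    simp only [join_R] at this
    omega

/-- permutation of a tree -/
noncomputable def toPerm : (t : BinaryTree Unit) → Equiv.Perm (Fin t.numNodes)
  | .nil => Equiv.refl _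
  | .node _ l r => join (toPerm l) (toPerm r)

/-- permutation of a tree with its size -/
noncomputable def toS (t : BinaryTree Unit) : Σ n, Equiv.Perm (Fin n) := ⟨t.numNodes, toPerm t⟩

theorem toS_inj : ∀ s t : BinaryTree Unit, toS s = toS t → s = t := by
  intro s
  induction s with
  | nil =>
    intro t h
    cases t with
    | nil => rfl
    | node _ l r =>
      have := congrArg Sigma.fst h
      simp [toS, BinaryTree.numNodes] at this
  | node u l r ihl ihr =>
    intro t h
    cases t with
    | nil =>
      have := congrArg Sigma.fst h
      simp [toS, BinaryTree.numNodes] at this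
    | node u' l' r' =>
      have := join_sigma_inj (A := toPerm l) (B := toPerm r) (A' := toPerm l') (B' := toPerm r') h
      rw [ihl _ this.1, ihr _ this.2]

theorem toPerm_avoids (t : BinaryTree Unit) : Avoids132 (toPerm t) := by
  induction t with
  | nil => rintro ⟨i, _⟩; exact i.elim0
  | node u l r ihl ihr => exact join_avoids _ _ ihl ihr

theorem exists_toS (n : ℕ) : ∀ σ : Equiv.Perm (Fin n), Avoids132 σ → ∃ t, toS t = ⟨n, σ⟩ := by
  induction n using Nat.strong_induction_on with
  | _ n ih =>
    intro σ hσ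
    cases n with
    | zero =>
      refine ⟨.nil, ?_⟩
      have : toPerm .nil = σ := Equiv.ext fun i => i.elim0
      rw [← this]; rfl
    | succ n =>
      obtain ⟨a, b, A, B, hA, hB, h⟩ := exists_join σ hσ
      have hn : a + b + 1 = n + 1 := congrArg Sigma.fst h
      obtain ⟨l, hl⟩ := ih a (by omega) A hA
      obtain ⟨r, hr⟩ := ih b (by omega) B hB
      refine ⟨.node () l r, ?_⟩
      rw [← h]
      have e : toS (.node () l r) = ⟨(toS l).1 + (toS r).1 + 1, join (toS l).2 (toS r).2⟩ := rfl
      rw [e, hl, hr]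

theorem sum_av (n : ℕ) {M : Type} [AddCommMonoid M] (F : (Σ n, Equiv.Perm (Fin n)) → M) :
    ∑ σ ∈ Av132 n, F ⟨n, σ⟩ = ∑ t ∈ BinaryTree.treesOfNumNodesEq n, F (toS t) := by
  symm
  have h1 : ∀ t ∈ BinaryTree.treesOfNumNodesEq n, ∃ σ : Equiv.Perm (Fin n), toS t = ⟨n, σ⟩ ∧
      Avoids132 σ := by
    intro t ht
    rw [BinaryTree.mem_treesOfNumNodesEq] at ht
    subst ht
    exact ⟨toPerm t, rfl, toPerm_avoids t⟩
  refine Finset.sum_bij (fun t ht => (h1 t ht).choose) ?_ ?_ ?_ ?_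
  · intro t ht
    simpa [Av132] using (h1 t ht).choose_spec.2
  · intro s hs t ht h
    apply toS_inj
    rw [(h1 s hs).choose_spec.1, (h1 t ht).choose_spec.1]
    exact congrArg _ h
  · intro σ hσ
    obtain ⟨t, ht⟩ := exists_toS n σ (by simpa [Av132] using hσ)
    have hm : t ∈ BinaryTree.treesOfNumNodesEq n := by
      rw [BinaryTree.mem_treesOfNumNodesEq]
      exact congrArg Sigma.fst ht
    refine ⟨t, hm, ?_⟩
    have := (h1 t hm).choose_spec.1
    have h3 := ht.symm.trans this
    simpa using h3.symm
  · intro t ht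
    rw [← (h1 t ht).choose_spec.1]

open BinaryTree in
theorem sum_trees_succ {M : Type} [AddCommMonoid M] (n : ℕ) (f : BinaryTree Unit → M) :
    ∑ t ∈ treesOfNumNodesEq (n + 1), f t = ∑ p ∈ antidiagonal n,
      ∑ l ∈ treesOfNumNodesEq p.1, ∑ r ∈ treesOfNumNodesEq p.2, f (.node () l r) := by
  rw [treesOfNumNodesEq_succ, Finset.sum_biUnion]
  · apply Finset.sum_congr rfl
    intro p _
    rw [Finset.sum_map, Finset.sum_product]
    rfl
  · intro p _ q _ hpq
    rw [Function.onFun, Finset.disjoint_left]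
    intro t ht ht'
    simp only [Finset.mem_map, Finset.mem_product, mem_treesOfNumNodesEq] at ht ht'
    obtain ⟨⟨l, r⟩, ⟨h1, h2⟩, rfl⟩ := ht
    obtain ⟨⟨l', r'⟩, ⟨h1', h2'⟩, h⟩ := ht'
    simp at h
    apply hpq
    ext
    · rw [← h1, ← h1', h.1]
    · rw [← h2, ← h2', h.2]

/-- weight generating function over trees -/
noncomputable def G (w : BinaryTree Unit → ℤ[X]) : PowerSeries ℤ[X] :=
  PowerSeries.mk fun n => ∑ t ∈ BinaryTree.treesOfNumNodesEq n, w t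

open BinaryTree in
theorem G_rec (w g h k : BinaryTree Unit → ℤ[X]) (hk : k .nil = 1) (c e : ℤ[X])
    (h0 : w .nil = 1) (h1 : ∀ l, w (.node () l .nil) = c * g l)
    (h2 : ∀ l r, r ≠ .nil → w (.node () l r) = e * h l * k r) :
    G w = 1 + PowerSeries.X * (PowerSeries.C c * G g + PowerSeries.C e * G h * (G k - 1)) := by
  ext1 n
  cases n with
  | zero => simp [G, h0]
  | succ n =>
    have hh : ∀ l r, w (.node () l r) =
        c * (g l * (if r = .nil then 1 else 0)) + e * (h l * (k r - if r = .nil then 1 else 0)) := by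
      intro l r
      by_cases hr : r = .nil
      · subst hr; simp [h1, hk]
      · simp [h2 l r hr, hr]; ring
    have hd : ∀ m, ∑ r ∈ treesOfNumNodesEq m, (if r = .nil then (1 : ℤ[X]) else 0)
        = PowerSeries.coeff m (1 : PowerSeries ℤ[X]) := by
      intro m
      rw [Finset.sum_ite_eq', PowerSeries.coeff_one]
      simp [mem_treesOfNumNodesEq, eq_comm]
    have e1 : PowerSeries.C c * G g + PowerSeries.C e * G h * (G k - 1) =
      PowerSeries.C c * (G g * 1) + PowerSeries.C e * (G h * (G k - 1)) := by ring
    rw [map_add, PowerSeries.coeff_succ_X_mul, e1, map_add, PowerSeries.coeff_C_mul,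
      PowerSeries.coeff_C_mul, PowerSeries.coeff_mul, PowerSeries.coeff_mul]
    have : PowerSeries.coeff (n+1) (1 : PowerSeries ℤ[X]) = 0 := by
      simp [PowerSeries.coeff_one]
    rw [this, zero_add]
    simp only [G, PowerSeries.coeff_mk, map_sub]
    rw [sum_trees_succ]
    simp only [hh, Finset.sum_add_distrib, ← Finset.mul_sum, ← Finset.sum_mul,
      Finset.sum_sub_distrib, hd]

/-- weight of a defect statistic -/
noncomputable def W (x y z : Prop) (t : BinaryTree Unit) : ℤ[X] := X ^ dfc x y z (toPerm t)

theorem W_nil (x y z : Prop) : W x y z .nil = 1 := by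
  have h : dfc x y z (toPerm .nil) = 0 := dfc_zero _ _ _ _
  rw [W, h, pow_zero]

open Classical in
theorem W_node_nil (x y z : Prop) (l : BinaryTree Unit) : W x y z (.node () l .nil) =
    (if x ∨ y ∨ z then X else 1) * W False y z l := by
  have : dfc x y z (toPerm (.node () l .nil)) = _ := dfc_join (toPerm l) (toPerm .nil) x y z
  rw [W, this]
  have h0 : (BinaryTree.nil : BinaryTree Unit).numNodes = 0 := rfl
  simp only [h0, and_true]
  have h1 : dfc x False z (toPerm .nil) = 0 := dfc_zero _ _ _ _
  rw [h1]
  split_ifs <;> simp [W, pow_succ, mul_comm]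

open Classical in
theorem W_node (x y z : Prop) (l r : BinaryTree Unit) (hr : r ≠ .nil) :
    W x y z (.node () l r) =
    (if x ∨ y then X else 1) * W False y False l * W x False z r := by
  have : dfc x y z (toPerm (.node () l r)) = _ := dfc_join (toPerm l) (toPerm r) x y z
  rw [W, this]
  have h0 : ¬ r.numNodes = 0 := by
    cases r with
    | nil => exact absurd rfl hr
    | node => simp [BinaryTree.numNodes]
  simp only [h0, and_false, or_false]
  split_ifs <;> simp [W, pow_add, mul_comm]

open Classical in
theorem G_W (x y z : Prop) : G (W x y z) = 1 + PowerSeries.X *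
    (PowerSeries.C (if x ∨ y ∨ z then X else 1) * G (W False y z) +
      PowerSeries.C (if x ∨ y then X else 1) * G (W False y False) * (G (W x False z) - 1)) :=
  G_rec _ _ _ _ (W_nil _ _ _) _ _ (W_nil _ _ _) (W_node_nil x y z) (W_node x y z)

/-- Catalan series -/
noncomputable def Cs : PowerSeries ℤ := PowerSeries.mk fun n => (catalan n : ℤ)

theorem G_F : G (W False False False) = PowerSeries.map (Polynomial.C) Cs := by
  ext1 n
  simp [G, W, dfc_F, Cs, BinaryTree.treesOfNumNodesEq_card_eq_catalan]

theorem Cs_eq : Cs = 1 + PowerSeries.X * Cs ^ 2 := by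
  ext n
  cases n with
  | zero => simp [Cs]
  | succ n =>
    rw [map_add, PowerSeries.coeff_succ_X_mul, pow_two, PowerSeries.coeff_mul]
    simp [Cs, PowerSeries.coeff_one, catalan_succ']

/-- The bivariate algebra. -/
theorem algebra_core {R : Type} [CommRing R] (t q c L S T U P : R)
    (hc : c = 1 + t * (c * c))
    (hL : L = 1 + t * (q * L + q * L * (c - 1)))
    (hS : S = 1 + t * (q * S + c * (S - 1)))
    (hT : T = 1 + t * (q * S + q * c * (T - 1)))
    (hU : U = 1 + t * (q * U + q * L * (S - 1)))
    (hP : P = 1 + t * (q * U + q * L * (T - 1))) :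
    ∃ E, P = 1 + q * t + q ^ 2 * (2 * t ^ 2) + q ^ 3 * (t ^ 3 + 4 * t ^ 3 * c)
      + q ^ 4 * (t ^ 4 + 8 * t ^ 4 * c ^ 2 + t ^ 4 * c) + q ^ 5 * E := by
  have e1 : c * (1 - t * c) = 1 := by linear_combination hc
  have e2 : L * (1 - t * q * c) = 1 := by linear_combination hL
  have e3 : S * (1 - t * q * c) = 1 := by
    linear_combination c * hS + (1 - S) * e1
  have e4 : S = L := by linear_combination L * e3 - S * e2
  subst e4
  have e5 : T = 1 + t * q * S ^ 2 := by
    linear_combination S * hT - (T - 1) * e2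
  obtain ⟨z, hz⟩ : ∃ z, z = t * c := ⟨_, rfl⟩
  have e6 : S = 1 + q * z + q ^ 2 * z ^ 2 + q ^ 3 * (z ^ 3 * S) := by
    subst hz
    linear_combination (1 + q * (t * c) + q ^ 2 * (t * c) ^ 2) * e2
  obtain ⟨E0, hE0⟩ : ∃ E0, E0 = z ^ 3 * S := ⟨_, rfl⟩
  rw [← hE0] at e6
  obtain ⟨E3, h3⟩ : ∃ E3, S * (S - 1) = q * z + 2 * q ^ 2 * z ^ 2 + q ^ 3 * E3 :=
    ⟨2 * z ^ 3 + q * z ^ 4 + 2 * (1 + q * z + q ^ 2 * z ^ 2) * E0 + q ^ 3 * E0 ^ 2 - E0, by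
      rw [e6]; ring⟩
  obtain ⟨E2, h2⟩ : ∃ E2, S ^ 3 = 1 + 3 * q * z + 6 * q ^ 2 * z ^ 2 + q ^ 3 * E2 :=
    ⟨7 * z ^ 3 + 6 * q * z ^ 4 + 3 * q ^ 2 * z ^ 5 + q ^ 3 * z ^ 6
      + 3 * (1 + q * z + q ^ 2 * z ^ 2) ^ 2 * E0 + 3 * (1 + q * z + q ^ 2 * z ^ 2) * q ^ 3 * E0 ^ 2
      + q ^ 6 * E0 ^ 3, by
      rw [e6]; ring⟩
  obtain ⟨E1, h1⟩ : ∃ E1, U = 1 + q * t + q ^ 2 * (t ^ 2 + t * z)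
      + q ^ 3 * (t ^ 3 + t ^ 2 * z + 2 * t * z ^ 2) + q ^ 4 * E1 := by
    refine ⟨t ^ 4 * U + t * E3 + t ^ 2 * (2 * z ^ 2 + q * E3)
      + (t ^ 3 + t ^ 4 * q) * (z + 2 * q * z ^ 2 + q ^ 2 * E3), ?_⟩
    linear_combination (1 + t * q + (t * q) ^ 2 + (t * q) ^ 3) * hU
      + (t * q + (t * q) ^ 2 + (t * q) ^ 3 + (t * q) ^ 4) * h3
  refine ⟨t * E1 + t ^ 2 * E2, ?_⟩
  have hP2 : P = 1 + t * q * U + t ^ 2 * q ^ 2 * S ^ 3 := by rw [hP, e5]; ring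
  rw [hP2, h1, h2, hz]
  ring

theorem coeff_q (n i : ℕ) (Y : PowerSeries ℤ[X]) :
    (PowerSeries.coeff n (PowerSeries.C (X : ℤ[X]) ^ i * Y)).coeff 4 =
      if i ≤ 4 then (PowerSeries.coeff n Y).coeff (4 - i) else 0 := by
  rw [← map_pow, PowerSeries.coeff_C_mul, Polynomial.coeff_X_pow_mul']

theorem coeff_map (n i : ℕ) (p : PowerSeries ℤ) :
    (PowerSeries.coeff n (PowerSeries.map (Polynomial.C : ℤ →+* ℤ[X]) p)).coeff i =
      if i = 0 then PowerSeries.coeff n p else 0 := by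
  rw [PowerSeries.coeff_map, Polynomial.coeff_C]

theorem coeff_P (n : ℕ) (hn : 5 ≤ n) :
    (PowerSeries.coeff n (G (W True True True))).coeff 4 =
      ((8 * catalan (n - 3) + catalan (n - 4) : ℕ) : ℤ) := by
  have hL := G_W False True False
  have hS := G_W False False True
  have hT := G_W True False True
  have hU := G_W False True True
  have hP := G_W True True True
  have hc : PowerSeries.map (Polynomial.C : ℤ →+* ℤ[X]) Cs =
      1 + PowerSeries.X * (PowerSeries.map (Polynomial.C : ℤ →+* ℤ[X]) Cs *
        PowerSeries.map (Polynomial.C : ℤ →+* ℤ[X]) Cs) := by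
    conv_lhs => rw [Cs_eq]
    simp [pow_two]
  simp only [G_F, or_true, true_or, or_false, false_or, if_true, if_false, map_one, one_mul]
    at hL hS hT hU hP
  obtain ⟨E, hE⟩ := algebra_core _ _ _ _ _ _ _ _ hc hL hS hT hU hP
  have hE' : G (W True True True) =
      PowerSeries.C (X : ℤ[X]) ^ 0 * PowerSeries.map (Polynomial.C : ℤ →+* ℤ[X]) 1
      + PowerSeries.C (X : ℤ[X]) ^ 1 *
        PowerSeries.map (Polynomial.C : ℤ →+* ℤ[X]) PowerSeries.X
      + PowerSeries.C (X : ℤ[X]) ^ 2 *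
        PowerSeries.map (Polynomial.C : ℤ →+* ℤ[X]) (2 * PowerSeries.X ^ 2)
      + PowerSeries.C (X : ℤ[X]) ^ 3 *
        PowerSeries.map (Polynomial.C : ℤ →+* ℤ[X])
          (PowerSeries.X ^ 3 + 4 * PowerSeries.X ^ 3 * Cs)
      + PowerSeries.C (X : ℤ[X]) ^ 4 *
        PowerSeries.map (Polynomial.C : ℤ →+* ℤ[X])
          (PowerSeries.X ^ 4 + 8 * PowerSeries.X ^ 4 * Cs ^ 2 + PowerSeries.X ^ 4 * Cs)
      + PowerSeries.C (X : ℤ[X]) ^ 5 * E := by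
    rw [hE]
    simp only [map_add, map_mul, map_pow, map_one, map_ofNat, PowerSeries.map_X]
    ring
  have hf : (PowerSeries.X ^ 4 + 8 * PowerSeries.X ^ 4 * Cs ^ 2 + PowerSeries.X ^ 4 * Cs
      : PowerSeries ℤ) = PowerSeries.X ^ 4 + PowerSeries.X ^ 3 * (PowerSeries.C 8 * (Cs - 1))
        + PowerSeries.X ^ 4 * Cs := by
    have h8 : (PowerSeries.C 8 : PowerSeries ℤ) = 8 := map_ofNat _ 8
    rw [h8]
    linear_combination (-8 * PowerSeries.X ^ 3) * Cs_eq
  obtain ⟨m, rfl⟩ : ∃ m, n = m + 5 := ⟨n - 5, by omega⟩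
  have a1 : m + 5 - 3 = m + 2 := by omega
  have a2 : m + 5 - 4 = m + 1 := by omega
  have key : ∀ p0 p1 p2 p3 p4 : PowerSeries ℤ, ∀ N : ℕ, (PowerSeries.coeff N (
      PowerSeries.C (X : ℤ[X]) ^ 0 * PowerSeries.map (Polynomial.C : ℤ →+* ℤ[X]) p0
      + PowerSeries.C (X : ℤ[X]) ^ 1 * PowerSeries.map (Polynomial.C : ℤ →+* ℤ[X]) p1
      + PowerSeries.C (X : ℤ[X]) ^ 2 * PowerSeries.map (Polynomial.C : ℤ →+* ℤ[X]) p2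
      + PowerSeries.C (X : ℤ[X]) ^ 3 * PowerSeries.map (Polynomial.C : ℤ →+* ℤ[X]) p3
      + PowerSeries.C (X : ℤ[X]) ^ 4 * PowerSeries.map (Polynomial.C : ℤ →+* ℤ[X]) p4
      + PowerSeries.C (X : ℤ[X]) ^ 5 * E)).coeff 4 = PowerSeries.coeff N p4 := by
    intro p0 p1 p2 p3 p4 N
    simp only [map_add, Polynomial.coeff_add, coeff_q, coeff_map]
    norm_num
  rw [hE', key]
  rw [hf, map_add, map_add, PowerSeries.coeff_X_pow_mul', PowerSeries.coeff_X_pow_mul',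
    PowerSeries.coeff_C_mul, a1, a2]
  simp [Cs, PowerSeries.coeff_X_pow, PowerSeries.coeff_one]

end MMPAux

/-- for `n ≥ 5`, the coefficient of `x^{n-4}` in
`Q_{n,132}^{(1,1,0,1)}(x)` equals `8·C_{n-3} + C_{n-4}`. -/
theorem stmt17 (n : ℕ) (hn : 5 ≤ n) :
    (Q n 1 1 0 1).coeff (n - 4) =
      ((8 * catalan (n - 3) + catalan (n - 4) : ℕ) : ℤ) := by
  have h1 : (Q n 1 1 0 1).coeff (n - 4) =
      (∑ σ ∈ Av132 n, (X : ℤ[X]) ^ (MMPAux.dfc True True True σ)).coeff 4 := by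
    rw [Q, Polynomial.finsetSum_coeff, Polynomial.finsetSum_coeff]
    apply Finset.sum_congr rfl
    intro σ _
    rw [Polynomial.coeff_X_pow, Polynomial.coeff_X_pow]
    have := MMPAux.mmp_add_dfc σ
    congr 1
    apply propext
    omega
  rw [h1, ← MMPAux.coeff_P n hn]
  rw [MMPAux.sum_av n (fun s => (X : ℤ[X]) ^ (MMPAux.dfc True True True s.2))]
  simp only [MMPAux.G, PowerSeries.coeff_mk]
  rfl
end
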